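/- Let f : ℝ² → ℝ² be a homeomorphism with a fixed point p, admitting a Lyapunov metric function U that satisfies the both-signs condition and condition HP; assume f has no singularities and that every connected component of ℝ² \ (Wˢ(p) ∪ Wᵘ(p)) is f-invariant. Then f is topologically conjugate to a linear hyperbolic automorphism: there exist λ > 1 and a homeomorphism h : ℝ² → ℝ² such that h ∘ f = L_λ ∘ h, where L_λ(x,y) = (λ·x, λ⁻¹·y). -/

import Mathlib

/-- First difference of `U` along the dynamics of `f`:
`V(x,y) = U(f(x),f(y)) − U(x,y)`. -/
def Vd (f : Equiv.Perm (ℝ × ℝ)) (U : ℝ × ℝ → ℝ × ℝ → ℝ) (x y : ℝ × ℝ) : ℝ :=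
  U (f x) (f y) - U x y

/-- Second difference of `U` along the dynamics of `f`:
`W(x,y) = U(f²(x),f²(y)) − 2·U(f(x),f(y)) + U(x,y)`. -/
def Wd (f : Equiv.Perm (ℝ × ℝ)) (U : ℝ × ℝ → ℝ × ℝ → ℝ) (x y : ℝ × ℝ) : ℝ :=
  U (f (f x)) (f (f y)) - 2 * U (f x) (f y) + U x y

/-- `U` is a Lyapunov metric function for `f`: a continuous metric on the plane
inducing the same topology as the Euclidean one, whose second difference along
`f` is strictly positive off the diagonal. -/
def IsLyapunovMetric (f : Equiv.Perm (ℝ × ℝ)) (U : ℝ × ℝ → ℝ × ℝ → ℝ) : Prop :=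
  Continuous (fun z : (ℝ × ℝ) × (ℝ × ℝ) => U z.1 z.2) ∧
  (∀ x y, 0 ≤ U x y) ∧ (∀ x y, U x y = U y x) ∧
  (∀ x y, U x y = 0 ↔ x = y) ∧
  (∀ x y z, U x z ≤ U x y + U y z) ∧
  (∀ x : ℝ × ℝ, ∀ ε > (0:ℝ), ∃ δ > (0:ℝ), ∀ y, dist x y < δ → U x y < ε) ∧
  (∀ x : ℝ × ℝ, ∀ ε > (0:ℝ), ∃ δ > (0:ℝ), ∀ y, U x y < δ → dist x y < ε) ∧
  (∀ x y : ℝ × ℝ, x ≠ y → 0 < Wd f U x y)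

/-- `B_k(x)`: the connected component containing `x` of `{w : U(x,w) ≤ k}`. -/
def Bk (U : ℝ × ℝ → ℝ × ℝ → ℝ) (k : ℝ) (x : ℝ × ℝ) : Set (ℝ × ℝ) :=
  connectedComponentIn {w : ℝ × ℝ | U x w ≤ k} x

/-- The both-signs condition: on the boundary of every `B_k(x)` the first
difference takes both a positive and a negative value. -/
def BothSigns (f : Equiv.Perm (ℝ × ℝ)) (U : ℝ × ℝ → ℝ × ℝ → ℝ) : Prop :=
  ∀ x : ℝ × ℝ, ∀ k > (0:ℝ),
    (∃ y ∈ frontier (Bk U k x), 0 < Vd f U x y) ∧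
    (∃ z ∈ frontier (Bk U k x), Vd f U x z < 0)

/-- The `k`-stable set of `x`. -/
def Sk (f : Equiv.Perm (ℝ × ℝ)) (U : ℝ × ℝ → ℝ × ℝ → ℝ) (k : ℝ)
    (x : ℝ × ℝ) : Set (ℝ × ℝ) :=
  {y | ∀ n : ℤ, 0 ≤ n → U ((f ^ n) x) ((f ^ n) y) ≤ k}

/-- The `k`-unstable set of `x`. -/
def Uk (f : Equiv.Perm (ℝ × ℝ)) (U : ℝ × ℝ → ℝ × ℝ → ℝ) (k : ℝ)
    (x : ℝ × ℝ) : Set (ℝ × ℝ) :=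
  {y | ∀ n : ℤ, n ≤ 0 → U ((f ^ n) x) ((f ^ n) y) ≤ k}

/-- `C_k(x)`: the connected component of `S_k(x)` containing `x`. -/
def Ck (f : Equiv.Perm (ℝ × ℝ)) (U : ℝ × ℝ → ℝ × ℝ → ℝ) (k : ℝ)
    (x : ℝ × ℝ) : Set (ℝ × ℝ) :=
  connectedComponentIn (Sk f U k x) x

/-- `D_k(x)`: the connected component of `U_k(x)` containing `x`. -/
def Dk (f : Equiv.Perm (ℝ × ℝ)) (U : ℝ × ℝ → ℝ × ℝ → ℝ) (k : ℝ)
    (x : ℝ × ℝ) : Set (ℝ × ℝ) :=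
  connectedComponentIn (Uk f U k x) x

/-- The global stable set of `x`. -/
def Ws (f : Equiv.Perm (ℝ × ℝ)) (U : ℝ × ℝ → ℝ × ℝ → ℝ)
    (x : ℝ × ℝ) : Set (ℝ × ℝ) :=
  {y | ∃ K > (0:ℝ), ∀ n : ℤ, 0 ≤ n → U ((f ^ n) x) ((f ^ n) y) ≤ K}

/-- The global unstable set of `x`. -/
def Wu (f : Equiv.Perm (ℝ × ℝ)) (U : ℝ × ℝ → ℝ × ℝ → ℝ)
    (x : ℝ × ℝ) : Set (ℝ × ℝ) :=
  {y | ∃ K > (0:ℝ), ∀ n : ℤ, n ≤ 0 → U ((f ^ n) x) ((f ^ n) y) ≤ K}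

/-- Condition HP: for every compact set `C`, the quotient
`|V(x,y) − V(x,z)| / W(x,y)` tends to `0` as `‖x‖ → ∞`, uniformly in `y,z ∈ C`. -/
def CondHP (f : Equiv.Perm (ℝ × ℝ)) (U : ℝ × ℝ → ℝ × ℝ → ℝ) : Prop :=
  ∀ C : Set (ℝ × ℝ), IsCompact C → ∀ ε > (0:ℝ), ∃ R > (0:ℝ),
    ∀ x : ℝ × ℝ, R < ‖x‖ → ∀ y ∈ C, ∀ z ∈ C,
      |Vd f U x y - Vd f U x z| / Wd f U x y < ε

/-- `p` has local product structure: there are a homeomorphism `h` of `ℝ²` onto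
an open subset of `ℝ²` containing `p` and `k > 0` carrying vertical lines onto
local stable components and horizontal lines onto local unstable components. -/
def HasLocalProductStructure (f : Equiv.Perm (ℝ × ℝ))
    (U : ℝ × ℝ → ℝ × ℝ → ℝ) (p : ℝ × ℝ) : Prop :=
  ∃ (h : ℝ × ℝ → ℝ × ℝ) (k : ℝ), 0 < k ∧
    Continuous h ∧ Function.Injective h ∧ IsOpenMap h ∧
    p ∈ Set.range h ∧
    ∀ a b : ℝ,
      h '' {q : ℝ × ℝ | q.1 = a} = Ck f U k (h (a, b)) ∩ Set.range h ∧
      h '' {q : ℝ × ℝ | q.2 = b} = Dk f U k (h (a, b)) ∩ Set.range h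

/-- `f` has no singularities: every point has local product structure. -/
def NoSingularities (f : Equiv.Perm (ℝ × ℝ))
    (U : ℝ × ℝ → ℝ × ℝ → ℝ) : Prop :=
  ∀ p : ℝ × ℝ, HasLocalProductStructure f U p

/-- Every connected component (quadrant) of the complement of
`Wˢ(p) ∪ Wᵘ(p)` is `f`-invariant. -/
def QuadrantsInvariant (f : Equiv.Perm (ℝ × ℝ))
    (U : ℝ × ℝ → ℝ × ℝ → ℝ) (p : ℝ × ℝ) : Prop :=
  ∀ q : ℝ × ℝ, q ∉ Ws f U p ∪ Wu f U p →
    (f : ℝ × ℝ → ℝ × ℝ) '' connectedComponentIn (Ws f U p ∪ Wu f U p)ᶜ q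
      = connectedComponentIn (Ws f U p ∪ Wu f U p)ᶜ q

section Helpers
open Set Filter Topology

/-- The working form of the stable relation: `U` is nonincreasing along the whole orbit. -/
def Rs (f : Equiv.Perm (ℝ × ℝ)) (U : ℝ × ℝ → ℝ × ℝ → ℝ) (x y : ℝ × ℝ) : Prop :=
  ∀ n : ℤ, U ((f ^ (n + 1)) x) ((f ^ (n + 1)) y) ≤ U ((f ^ n) x) ((f ^ n) y)

theorem convex_diff_mono (a : ℤ → ℝ) (h : ∀ n, 0 ≤ a (n + 2) - 2 * a (n + 1) + a n) (m : ℤ)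
    (k : ℕ) : a (m + 1) - a m ≤ a (m + k + 1) - a (m + k) := by
  induction k with
  | zero => simp
  | succ k ih =>
    have := h (m + k)
    push_cast
    have e1 : m + (k + 1 : ℤ) + 1 = m + k + 2 := by ring
    have e2 : m + (k + 1 : ℤ) = m + k + 1 := by ring
    rw [e1, e2]; linarith

theorem convex_bdd (a : ℤ → ℝ) (h : ∀ n, 0 ≤ a (n + 2) - 2 * a (n + 1) + a n) (K : ℝ)
    (hK : ∀ n, 0 ≤ n → a n ≤ K) (m : ℤ) : a (m + 1) ≤ a m := by
  by_contra hc
  push Not at hc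
  set d := a (m + 1) - a m with hd
  have hd0 : 0 < d := by linarith
  have key : ∀ k : ℕ, a m + k * d ≤ a (m + k) := by
    intro k
    induction k with
    | zero => simp
    | succ k ih =>
      have := convex_diff_mono a h m k
      push_cast
      rw [← add_assoc]; nlinarith
  obtain ⟨k0, hk0⟩ := exists_nat_gt ((K - a m) / d)
  rw [div_lt_iff₀ hd0] at hk0
  set k := k0 + m.natAbs
  have h1 := key k
  have h2 := hK (m + k) (by omega)
  have h3 : (k0 : ℝ) ≤ k := by simp [k]
  nlinarith

/-- The symmetric package of properties of `(f, U)` used in the proof. -/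
structure Sys (f : Equiv.Perm (ℝ × ℝ)) (U : ℝ × ℝ → ℝ × ℝ → ℝ) : Prop where
  cf : Continuous f
  cf' : Continuous (f⁻¹ : Equiv.Perm (ℝ × ℝ))
  cU : Continuous (fun z : (ℝ × ℝ) × (ℝ × ℝ) => U z.1 z.2)
  sym : ∀ x y, U x y = U y x
  zero : ∀ x y, U x y = 0 ↔ x = y
  tri : ∀ x y z, U x z ≤ U x y + U y z
  top : ∀ x : ℝ × ℝ, ∀ ε > (0:ℝ), ∃ δ > (0:ℝ), ∀ y, U x y < δ → dist x y < ε
  conv : ∀ x y, x ≠ y → 0 < Wd f U x y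
  far : ∀ C : Set (ℝ × ℝ), IsCompact C → ∃ R : ℝ, ∀ x, R < ‖x‖ → ∀ y ∈ C, ∀ z ∈ C,
    Rs f U x y → U (f x) (f z) < U x z
  far' : ∀ C : Set (ℝ × ℝ), IsCompact C → ∃ R : ℝ, ∀ x, R < ‖x‖ → ∀ y ∈ C, ∀ z ∈ C,
    Rs f⁻¹ U x y → U (f⁻¹ x) (f⁻¹ z) < U x z
  chart : ∀ p, ∃ h : ℝ × ℝ → ℝ × ℝ, Continuous h ∧ Function.Injective h ∧ IsOpenMap h ∧
    p ∈ range h ∧ (∀ q r, Rs f U (h q) (h r) ↔ q.1 = r.1) ∧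
    (∀ q r, Rs f⁻¹ U (h q) (h r) ↔ q.2 = r.2)

theorem Wd_nonneg {f U} (hz : ∀ x y : ℝ × ℝ, U x y = 0 ↔ x = y)
    (hc : ∀ x y, x ≠ y → 0 < Wd f U x y) (x y) : 0 ≤ Wd f U x y := by
  by_cases h : x = y
  · subst h
    simp [Wd, (hz _ _).2 rfl]
  · exact (hc x y h).le

theorem zpow_succ_apply (f : Equiv.Perm (ℝ × ℝ)) (n : ℤ) (x) : (f ^ (n + 1)) x = f ((f ^ n) x) := by
  rw [add_comm, zpow_add]; simp

theorem inv_zpow_apply (f : Equiv.Perm (ℝ × ℝ)) (n : ℤ) (x) : (f⁻¹ ^ n) x = (f ^ (-n)) x := by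
  rw [inv_zpow, zpow_neg]

theorem orbit_conv {f U} (hz : ∀ x y : ℝ × ℝ, U x y = 0 ↔ x = y)
    (hc : ∀ x y, x ≠ y → 0 < Wd f U x y) (x y) (n : ℤ) :
    0 ≤ U ((f ^ (n + 2)) x) ((f ^ (n + 2)) y) - 2 * U ((f ^ (n + 1)) x) ((f ^ (n + 1)) y)
      + U ((f ^ n) x) ((f ^ n) y) := by
  have := Wd_nonneg hz hc ((f ^ n) x) ((f ^ n) y)
  rw [Wd, ← zpow_succ_apply, ← zpow_succ_apply, ← zpow_succ_apply, ← zpow_succ_apply] at this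
  simpa [add_assoc, one_add_one_eq_two] using this

theorem Rs_of_bdd {f U} (hz : ∀ x y : ℝ × ℝ, U x y = 0 ↔ x = y)
    (hc : ∀ x y, x ≠ y → 0 < Wd f U x y) {x y} {K : ℝ}
    (h : ∀ n : ℤ, 0 ≤ n → U ((f ^ n) x) ((f ^ n) y) ≤ K) : Rs f U x y :=
  fun n => convex_bdd (fun n => U ((f ^ n) x) ((f ^ n) y)) (orbit_conv hz hc x y) K h n

theorem Rs.bdd {f U x y} (h : Rs f U x y) (m : ℤ) (k : ℕ) :
    U ((f ^ (m + k)) x) ((f ^ (m + k)) y) ≤ U ((f ^ m) x) ((f ^ m) y) := by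
  induction k with
  | zero => simp
  | succ k ih => push_cast; rw [← add_assoc]; exact (h _).trans ih

theorem Rs.bdd' {f U x y} (h : Rs f U x y) {m n : ℤ} (hmn : m ≤ n) :
    U ((f ^ n) x) ((f ^ n) y) ≤ U ((f ^ m) x) ((f ^ m) y) := by
  have := h.bdd m (n - m).toNat
  rwa [show m + ((n - m).toNat : ℤ) = n by omega] at this

theorem Rs.iter {f U x y} (h : Rs f U x y) (m : ℤ) : Rs f U ((f ^ m) x) ((f ^ m) y) := by
  intro n
  rw [← Equiv.Perm.mul_apply, ← Equiv.Perm.mul_apply, ← Equiv.Perm.mul_apply,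
    ← Equiv.Perm.mul_apply, ← zpow_add, ← zpow_add]
  have := h (n + m)
  rwa [show n + m + 1 = n + 1 + m by ring] at this

theorem Rs.pos {f U x y} (h : Rs f⁻¹ U x y) : U x y ≤ U (f x) (f y) := by
  have := h (-1)
  simpa using this

theorem Rs_and {f U} (hz : ∀ x y : ℝ × ℝ, U x y = 0 ↔ x = y)
    (hc : ∀ x y, x ≠ y → 0 < Wd f U x y) {x y} (h : Rs f U x y) (h' : Rs f⁻¹ U x y) : x = y := by
  by_contra hne
  have h0 := hc x y hne
  have h1 := h 0
  have h2 := h 1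
  have h3 := h' (-1)
  have h4 := h' (-2)
  simp only [inv_zpow_apply] at h3 h4
  rw [zpow_succ_apply, zpow_succ_apply] at h1 h2
  norm_num [pow_two, zpow_two] at h1 h2 h3 h4
  unfold Wd at h0
  linarith

namespace Sys
variable {f : Equiv.Perm (ℝ × ℝ)} {U : ℝ × ℝ → ℝ × ℝ → ℝ}

theorem Wd_inv (x y) : Wd f⁻¹ U x y = Wd f U (f⁻¹ (f⁻¹ x)) (f⁻¹ (f⁻¹ y)) := by
  unfold Wd; simp; ring

theorem conv' (S : Sys f U) (x y) (h : x ≠ y) : 0 < Wd f⁻¹ U x y := by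
  rw [Wd_inv]
  exact S.conv _ _ (by simpa using h)

theorem inv (S : Sys f U) : Sys f⁻¹ U where
  cf := S.cf'
  cf' := by simpa using S.cf
  cU := S.cU
  sym := S.sym
  zero := S.zero
  tri := S.tri
  top := S.top
  conv := S.conv'
  far := S.far'
  far' := by simpa using S.far
  chart := by
    intro p
    obtain ⟨h, hc, hi, ho, ⟨q, hq⟩, hs, hu⟩ := S.chart p
    refine ⟨h ∘ Prod.swap, hc.comp continuous_swap, hi.comp Prod.swap_injective,
      ho.comp (Homeomorph.prodComm ℝ ℝ).isOpenMap, ⟨q.swap, by simpa using hq⟩, ?_, ?_⟩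
    · intro q r; simpa using hu q.swap r.swap
    · intro q r; simpa using hs q.swap r.swap

theorem bdd_iff (S : Sys f U) (x y) :
    Rs f U x y ↔ ∃ K, ∀ n : ℤ, 0 ≤ n → U ((f ^ n) x) ((f ^ n) y) ≤ K :=
  ⟨fun h => ⟨_, fun _ hn => h.bdd' hn⟩, fun ⟨_, h⟩ => Rs_of_bdd S.zero S.conv h⟩

theorem refl (S : Sys f U) (x) : Rs f U x x := by
  intro n; rw [(S.zero _ _).2 rfl, (S.zero _ _).2 rfl]

theorem symm (S : Sys f U) {x y} (h : Rs f U x y) : Rs f U y x := by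
  intro n; rw [S.sym, S.sym _ ((f ^ n) x)]; exact h n

theorem trans (S : Sys f U) {x y z} (h : Rs f U x y) (h' : Rs f U y z) : Rs f U x z := by
  rw [S.bdd_iff] at *
  obtain ⟨K, hK⟩ := h
  obtain ⟨L, hL⟩ := h'
  exact ⟨K + L, fun n hn => (S.tri _ _ _).trans (add_le_add (hK n hn) (hL n hn))⟩

theorem cpow (S : Sys f U) (n : ℤ) : Continuous (f ^ n : Equiv.Perm (ℝ × ℝ)) := by
  induction n with
  | zero => simpa using continuous_id
  | succ n ih =>
    have : ((f ^ ((n : ℤ) + 1) : Equiv.Perm (ℝ × ℝ)) : ℝ × ℝ → ℝ × ℝ) = f ∘ (f ^ (n : ℤ)) := by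
      funext x; exact zpow_succ_apply f n x
    rw [this]; exact S.cf.comp ih
  | pred n ih =>
    have : ((f ^ (-(n : ℤ) - 1) : Equiv.Perm (ℝ × ℝ)) : ℝ × ℝ → ℝ × ℝ)
        = (f⁻¹ : Equiv.Perm (ℝ × ℝ)) ∘ (f ^ (-n : ℤ)) := by
      funext x
      have := zpow_succ_apply f (-(n : ℤ) - 1) x
      simp only [sub_add_cancel] at this
      rw [Function.comp_apply, this]
      exact (f.symm_apply_apply _).symm
    rw [this]; exact S.cf'.comp ih

theorem closed (S : Sys f U) : IsClosed {q : (ℝ × ℝ) × (ℝ × ℝ) | Rs f U q.1 q.2} := by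
  unfold Rs
  simp only [ofPred_forall]
  refine isClosed_iInter fun n => isClosed_le ?_ ?_
  · exact S.cU.comp (((S.cpow _).comp continuous_fst).prodMk ((S.cpow _).comp continuous_snd))
  · exact S.cU.comp (((S.cpow _).comp continuous_fst).prodMk ((S.cpow _).comp continuous_snd))

theorem compactness (S : Sys f U) (C : Set (ℝ × ℝ)) (hC : IsCompact C) :
    ∃ K : Set (ℝ × ℝ), IsCompact K ∧ ∀ x, ∀ y ∈ C, ∀ z ∈ C, Rs f U x y → Rs f⁻¹ U x z → x ∈ K := by
  obtain ⟨R, hR⟩ := S.far C hC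
  refine ⟨Metric.closedBall 0 R, isCompact_closedBall _ _, ?_⟩
  intro x y hy z hz hs hu
  by_contra hx
  have := hR x (by simpa using hx) y hy z hz hs
  linarith [hu.pos]

/-- Points stably related to a fixed point converge to it. -/
theorem contract (S : Sys f U) {p : ℝ × ℝ} (hp : f p = p) {y} (hy : Rs f U p y) :
    Tendsto (fun n : ℕ => (f ^ (n : ℤ)) y) atTop (𝓝 p) := by
  have hpn : ∀ n : ℤ, (f ^ n) p = p := fun n => by
    exact Equiv.Perm.zpow_apply_eq_self_of_apply_eq_self hp n
  have hmono : Antitone (fun n : ℕ => U p ((f ^ (n : ℤ)) y)) := by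
    intro m n hmn
    have := hy.bdd' (m := m) (n := n) (by exact_mod_cast hmn)
    simpa only [hpn] using this
  have hnn : ∀ x y, 0 ≤ U x y := by
    intro x y
    have := S.tri x y x
    rw [(S.zero x x).2 rfl, S.sym y x] at this
    linarith
  -- limit of distances
  obtain ⟨c, hc⟩ : ∃ c, Tendsto (fun n : ℕ => U p ((f ^ (n : ℤ)) y)) atTop (𝓝 c) := by
    refine ⟨_, tendsto_atTop_ciInf hmono ⟨0, ?_⟩⟩
    rintro _ ⟨n, rfl⟩; exact hnn _ _
  by_cases hc0 : c = 0
  · subst hc0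
    rw [Metric.tendsto_nhds]
    intro ε hε
    obtain ⟨δ, hδ, h⟩ := S.top p ε hε
    filter_upwards [hc.eventually (gt_mem_nhds hδ)] with n hn
    rw [dist_comm]; exact h _ hn
  exfalso
  -- no cluster points
  have hnc : ∀ q, ¬ MapClusterPt q atTop (fun n : ℕ => (f ^ (n : ℤ)) y) := by
    intro q hq
    obtain ⟨F, hF, hFq⟩ := mapClusterPt_iff_ultrafilter.1 hq
    have cUp : Continuous (U p) := S.cU.comp (continuous_const.prodMk continuous_id)
    have hv : ∀ k : ℕ, U p ((f ^ (k : ℤ)) q) = c := by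
      intro k
      have h1 : Tendsto (fun n : ℕ => U p ((f ^ (k : ℤ)) ((f ^ (n : ℤ)) y))) F
          (𝓝 (U p ((f ^ (k : ℤ)) q))) :=
        ((cUp.comp (S.cpow k)).tendsto q).comp hFq
      have h2 : Tendsto (fun n : ℕ => U p ((f ^ (k : ℤ)) ((f ^ (n : ℤ)) y))) F (𝓝 c) := by
        have := (hc.comp (tendsto_add_atTop_nat k)).mono_left hF
        refine this.congr fun n => ?_
        simp only [Function.comp]
        rw [← Equiv.Perm.mul_apply, ← zpow_add]; push_cast; rw [add_comm]
      exact tendsto_nhds_unique h1 h2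
    have h0 := hv 0
    have h1 := hv 1
    have h2 := hv 2
    have hne : p ≠ q := by
      rintro rfl
      exact hc0 (by rw [← h0]; simp [(S.zero _ _).2 rfl])
    have := S.conv p q hne
    simp [pow_two] at h0 h1 h2
    unfold Wd at this
    rw [hp, hp, h0, h1, h2] at this
    linarith
  have hinf : ∀ R : ℝ, ∀ᶠ n : ℕ in atTop, R < ‖(f ^ (n : ℤ)) y‖ := by
    intro R
    by_contra hcon
    have : ∃ᶠ n : ℕ in atTop, (f ^ (n : ℤ)) y ∈ Metric.closedBall (0 : ℝ × ℝ) R := by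
      intro h; apply hcon
      filter_upwards [h] with n hn
      simpa using hn
    obtain ⟨q, -, hq⟩ := (isCompact_closedBall (0 : ℝ × ℝ) R).exists_mapClusterPt_of_frequently this
    exact hnc q hq
  -- a nontrivial unstable point
  obtain ⟨z₀, hz₀, hzp⟩ : ∃ z₀, Rs f⁻¹ U p z₀ ∧ z₀ ≠ p := by
    obtain ⟨h, -, hi, -, ⟨q, rfl⟩, -, hu⟩ := S.chart p
    refine ⟨h (q.1 + 1, q.2), (hu _ _).2 rfl, fun e => ?_⟩
    have := congrArg Prod.fst (hi e)
    simp at this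
  apply hzp
  refine (Rs_and S.zero S.conv (Rs_of_bdd S.zero S.conv (K := 2 * U p y + U p z₀) ?_) hz₀).symm
  intro j hj
  rw [hpn]
  set z := (f ^ j) z₀ with hz
  obtain ⟨R, hR⟩ := S.far {p, z} (by simp)
  obtain ⟨n, hn, hnj⟩ := ((hinf R).and (eventually_ge_atTop j.toNat)).exists
  have hlt := hR _ hn p (by simp) z (by simp) (by
    have := S.symm (hy.iter n)
    rwa [hpn] at this)
  -- pull back
  have hnj' : j ≤ n := by omega
  have hdn : ∀ m : ℕ, m ≤ n → U ((f ^ (n : ℤ)) y) z ≤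
      U ((f ^ ((n : ℤ) - m)) y) ((f ^ (-(m : ℤ))) z) := by
    intro m hm
    induction m with
    | zero => simp
    | succ m ih =>
      refine (ih (by omega)).trans ?_
      have hd := convex_diff_mono (fun i => U ((f ^ i) ((f ^ (n : ℤ)) y)) ((f ^ i) z))
        (orbit_conv S.zero S.conv _ _) (-(m + 1 : ℤ)) (m + 1)
      simp only [← Equiv.Perm.mul_apply, ← zpow_add] at hd
      push_cast at hd ⊢
      have e1 : -((m : ℤ) + 1) + (m + 1) + 1 = 1 := by ring
      have e2 : -((m : ℤ) + 1) + (m + 1) = 0 := by ring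
      have e3 : -((m : ℤ) + 1) + 1 = -m := by ring
      have e4 : (1 : ℤ) + n = n + 1 := by ring
      rw [e1, e2, e3, e4, zpow_succ_apply] at hd
      simp only [zpow_one, zero_add, zpow_zero, Equiv.Perm.one_apply] at hd
      have e5 : (-m + n : ℤ) = n - m := by ring
      have e6 : (-(m + 1) + n : ℤ) = n - (m + 1) := by ring
      rw [e5, e6] at hd
      linarith
  have h1 := hdn n le_rfl
  simp only [sub_self, zpow_zero, Equiv.Perm.one_apply] at h1
  have h2 : U p ((f ^ (-(n : ℤ))) z) ≤ U p z₀ := by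
    have := hz₀.bdd' (m := 0) (n := n - j) (by omega)
    simp only [inv_zpow_apply, hpn] at this
    rw [hz, ← Equiv.Perm.mul_apply, ← zpow_add]
    simpa [sub_eq_add_neg, add_comm] using this
  have h3 : U p ((f ^ (n : ℤ)) y) ≤ U p y := by simpa using hmono (Nat.zero_le n)
  have h4 := S.tri p ((f ^ (n : ℤ)) y) z
  have h5 := S.tri y p ((f ^ (-(n : ℤ))) z)
  rw [S.sym y p] at h5
  linarith

end Sys

theorem Sys.mk' (f : Equiv.Perm (ℝ × ℝ)) (hf : Continuous f) (hf' : Continuous f.symm)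
    (U : ℝ × ℝ → ℝ × ℝ → ℝ) (hU : IsLyapunovMetric f U) (hHP : CondHP f U)
    (hNS : NoSingularities f U) : Sys f U := by
  obtain ⟨cU, -, sym, zero, tri, -, top, conv⟩ := hU
  have cfi : Continuous (f⁻¹ : Equiv.Perm (ℝ × ℝ)) := hf'
  have conv' : ∀ x y, x ≠ y → 0 < Wd f⁻¹ U x y := by
    intro x y h
    rw [Sys.Wd_inv]
    exact conv _ _ (by simpa using h)
  have notin : ∀ C : Set (ℝ × ℝ), IsCompact C → ∃ R : ℝ, ∀ x, R < ‖x‖ → x ∉ C := by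
    intro C hC
    obtain ⟨R, hR⟩ := hC.isBounded.exists_norm_le
    exact ⟨R, fun x hx hxC => absurd (hR x hxC) (by simpa using hx)⟩
  refine ⟨hf, cfi, cU, sym, zero, tri, top, conv, ?_, ?_, ?_⟩
  · intro C hC
    obtain ⟨R, -, hR⟩ := hHP C hC 1 one_pos
    obtain ⟨R', hR'⟩ := notin C hC
    refine ⟨max R R', fun x hx y hy z hz hs => ?_⟩
    have hxC := hR' x ((le_max_right _ _).trans_lt hx)
    have hW := conv x y (by rintro rfl; exact hxC hy)
    have := hR x ((le_max_left _ _).trans_lt hx) y hy z hz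
    rw [div_lt_one hW, abs_lt] at this
    have h1 := hs 1
    rw [zpow_succ_apply, zpow_succ_apply] at h1
    simp only [zpow_one] at h1
    unfold Wd Vd at *
    linarith [this.1, this.2]
  · intro C hC
    -- pull back by two iterates
    set g : ℝ × ℝ → ℝ × ℝ := fun x => f⁻¹ (f⁻¹ x) with hg
    have cg : Continuous g := cfi.comp cfi
    have hD : IsCompact (g '' C) := hC.image cg
    obtain ⟨R, -, hR⟩ := hHP (g '' C) hD 1 one_pos
    obtain ⟨R', hR'⟩ := notin C hC
    have hB : IsCompact ((fun x => f (f x)) '' Metric.closedBall (0 : ℝ × ℝ) R) :=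
      (isCompact_closedBall _ _).image (hf.comp hf)
    obtain ⟨R'', hR''⟩ := notin _ hB
    refine ⟨max R' R'', fun x hx y hy z hz hu => ?_⟩
    have hxC := hR' x ((le_max_left _ _).trans_lt hx)
    have hxB := hR'' x ((le_max_right _ _).trans_lt hx)
    have hgx : R < ‖g x‖ := by
      by_contra hcon
      exact hxB ⟨g x, by simpa using hcon, by simp [hg]⟩
    have hW : 0 < Wd f U (g x) (g z) := conv _ _ (by
      intro e
      have : x = z := by simpa [hg] using e
      exact hxC (this ▸ hz))
    have := hR (g x) hgx (g z) ⟨z, hz, rfl⟩ (g y) ⟨y, hy, rfl⟩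
    rw [div_lt_one hW, abs_lt] at this
    have h1 := hu 1
    rw [zpow_succ_apply, zpow_succ_apply] at h1
    simp only [zpow_one] at h1
    have hff : ∀ w, f (f⁻¹ w) = w := fun w => f.apply_symm_apply w
    unfold Wd Vd at *
    simp only [hg, hff] at *
    linarith [this.1, this.2]
  · intro p
    obtain ⟨h, k, -, hc, hi, ho, hp, hh⟩ := hNS p
    have trans : ∀ g : Equiv.Perm (ℝ × ℝ), (∀ x y, x ≠ y → 0 < Wd g U x y) → ∀ x y z,
        Rs g U x y → Rs g U y z → Rs g U x z := by
      intro g hg x y z h1 h2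
      refine Rs_of_bdd zero hg (K := U x y + U y z) fun n hn => (tri _ ((g ^ n) y) _).trans ?_
      exact add_le_add (by simpa using h1.bdd' hn) (by simpa using h2.bdd' hn)
    have symm : ∀ g : Equiv.Perm (ℝ × ℝ), ∀ x y, Rs g U x y → Rs g U y x := by
      intro g x y h n; rw [sym, sym _ ((g ^ n) x)]; exact h n
    have hs : ∀ q r : ℝ × ℝ, q.1 = r.1 → Rs f U (h q) (h r) := by
      intro q r e
      have h1 : h r ∈ h '' {q' : ℝ × ℝ | q'.1 = q.1} := ⟨r, e.symm, rfl⟩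
      rw [(hh q.1 q.2).1] at h1
      exact Rs_of_bdd zero conv (connectedComponentIn_subset _ _ h1.1)
    have hu : ∀ q r : ℝ × ℝ, q.2 = r.2 → Rs f⁻¹ U (h q) (h r) := by
      intro q r e
      have h1 : h r ∈ h '' {q' : ℝ × ℝ | q'.2 = q.2} := ⟨r, e.symm, rfl⟩
      rw [(hh q.1 q.2).2] at h1
      have h2 := connectedComponentIn_subset _ _ h1.1
      refine Rs_of_bdd zero conv' (K := k) fun n hn => ?_
      rw [inv_zpow_apply, inv_zpow_apply]
      exact h2 (-n) (by omega)
    refine ⟨h, hc, hi, ho, hp, fun q r => ⟨fun e => ?_, hs q r⟩, fun q r => ⟨fun e => ?_, hu q r⟩⟩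
    · have h1 : Rs f U (h (q.1, r.2)) (h r) := trans f conv _ _ _ (hs (q.1, r.2) q rfl) e
      have h2 := hi (Rs_and zero conv h1 (hu (q.1, r.2) r rfl))
      simpa using congrArg Prod.fst h2
    · have h1 : Rs f⁻¹ U (h (r.1, q.2)) (h r) := trans _ conv' _ _ _ (hu (r.1, q.2) q rfl) e
      have h2 := hi (Rs_and zero conv (hs (r.1, q.2) r rfl) h1)
      simpa using congrArg Prod.snd h2

/-- Two transverse closed equivalence relations with local product charts. -/
structure PS (s u : ℝ × ℝ → ℝ × ℝ → Prop) : Prop where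
  srefl : ∀ x, s x x
  ssymm : ∀ {x y}, s x y → s y x
  strans : ∀ {x y z}, s x y → s y z → s x z
  urefl : ∀ x, u x x
  usymm : ∀ {x y}, u x y → u y x
  utrans : ∀ {x y z}, u x y → u y z → u x z
  su : ∀ {x y}, s x y → u x y → x = y
  cs : IsClosed {q : (ℝ × ℝ) × (ℝ × ℝ) | s q.1 q.2}
  cu : IsClosed {q : (ℝ × ℝ) × (ℝ × ℝ) | u q.1 q.2}
  comp : ∀ C : Set (ℝ × ℝ), IsCompact C →
    ∃ K : Set (ℝ × ℝ), IsCompact K ∧ ∀ x, ∀ y ∈ C, ∀ z ∈ C, s x y → u x z → x ∈ K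
  chart : ∀ p, ∃ h : ℝ × ℝ → ℝ × ℝ, Continuous h ∧ Function.Injective h ∧ IsOpenMap h ∧
    p ∈ range h ∧ (∀ q r, s (h q) (h r) ↔ q.1 = r.1) ∧ (∀ q r, u (h q) (h r) ↔ q.2 = r.2)

theorem Sys.ps {f U} (S : Sys f U) : PS (Rs f U) (Rs f⁻¹ U) where
  srefl := S.refl
  ssymm := S.symm
  strans := S.trans
  urefl := S.inv.refl
  usymm := S.inv.symm
  utrans := S.inv.trans
  su := Rs_and S.zero S.conv
  cs := S.closed
  cu := S.inv.closed
  comp := S.compactness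
  chart := S.chart

/-- Holonomy relation: saturations of neighbourhoods of `x'` are neighbourhoods of `x`. -/
def Hol (s : ℝ × ℝ → ℝ × ℝ → Prop) (x x' : ℝ × ℝ) : Prop :=
  ∀ N ∈ 𝓝 x', {a | ∃ b ∈ N, s a b} ∈ 𝓝 x

namespace PS
variable {s u : ℝ × ℝ → ℝ × ℝ → Prop}

theorem swap (P : PS s u) : PS u s where
  srefl := P.urefl
  ssymm := P.usymm
  strans := P.utrans
  urefl := P.srefl
  usymm := P.ssymm
  utrans := P.strans
  su := fun h h' => P.su h' h
  cs := P.cu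
  cu := P.cs
  comp := by
    intro C hC
    obtain ⟨K, hK, h⟩ := P.comp C hC
    exact ⟨K, hK, fun x y hy z hz hs hu => h x z hz y hy hu hs⟩
  chart := by
    intro p
    obtain ⟨h, hc, hi, ho, ⟨q, hq⟩, hs, hu⟩ := P.chart p
    refine ⟨h ∘ Prod.swap, hc.comp continuous_swap, hi.comp Prod.swap_injective,
      ho.comp (Homeomorph.prodComm ℝ ℝ).isOpenMap, ⟨q.swap, by simpa using hq⟩, ?_, ?_⟩
    · intro q r; simpa using hu q.swap r.swap
    · intro q r; simpa using hs q.swap r.swap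

theorem uniq (P : PS s u) {x x' y z} (h1 : s x y) (h2 : u x z) (h1' : s x' y) (h2' : u x' z) :
    x = x' :=
  P.su (P.strans h1 (P.ssymm h1')) (P.utrans h2 (P.usymm h2'))

theorem lim (P : PS s u) {ι : Type*} {l : Filter ι} [l.NeBot] {X Y Z : ι → ℝ × ℝ} {y z : ℝ × ℝ}
    (hY : Tendsto Y l (𝓝 y)) (hZ : Tendsto Z l (𝓝 z))
    (hX : ∀ᶠ i in l, s (X i) (Y i) ∧ u (X i) (Z i)) :
    ∃ x, s x y ∧ u x z ∧ Tendsto X l (𝓝 x) := by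
  obtain ⟨K, hK, hKx⟩ := P.comp (Metric.closedBall y 1 ∪ Metric.closedBall z 1)
    ((isCompact_closedBall _ _).union (isCompact_closedBall _ _))
  have hXK : ∀ᶠ i in l, X i ∈ K := by
    filter_upwards [hX, hY.eventually (Metric.closedBall_mem_nhds y one_pos),
      hZ.eventually (Metric.closedBall_mem_nhds z one_pos)] with i h1 h2 h3
    exact hKx _ _ (Or.inl h2) _ (Or.inr h3) h1.1 h1.2
  have key : ∀ x, MapClusterPt x l X → s x y ∧ u x z := by
    intro x hx
    obtain ⟨F, hF, hFx⟩ := mapClusterPt_iff_ultrafilter.1 hx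
    have h1 : Tendsto (fun i => (X i, Y i)) F (𝓝 (x, y)) := hFx.prodMk_nhds (hY.mono_left hF)
    have h2 : Tendsto (fun i => (X i, Z i)) F (𝓝 (x, z)) := hFx.prodMk_nhds (hZ.mono_left hF)
    exact ⟨P.cs.mem_of_tendsto h1 (hF (hX.mono fun i h => h.1)),
      P.cu.mem_of_tendsto h2 (hF (hX.mono fun i h => h.2))⟩
  obtain ⟨x, -, hx⟩ := hK.exists_mapClusterPt (f := l) (u := X) (le_principal_iff.2 hXK)
  refine ⟨x, (key x hx).1, (key x hx).2, ?_⟩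
  refine hK.tendsto_nhds_of_unique_mapClusterPt hXK fun x' _ hx' => ?_
  exact P.uniq (key x' hx').1 (key x' hx').2 (key x hx).1 (key x hx).2

theorem D_closed (P : PS s u) :
    IsClosed {q : (ℝ × ℝ) × (ℝ × ℝ) | ∃ x, s x q.1 ∧ u x q.2} := by
  rw [← closure_subset_iff_isClosed]
  rintro ⟨y, z⟩ hq
  set D := {q : (ℝ × ℝ) × (ℝ × ℝ) | ∃ x, s x q.1 ∧ u x q.2} with hD
  have : (𝓝[D] (y, z)).NeBot := mem_closure_iff_nhdsWithin_neBot.1 hq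
  classical
  have hex : ∀ q : (ℝ × ℝ) × (ℝ × ℝ), ∃ x, q ∈ D → s x q.1 ∧ u x q.2 := by
    intro q
    by_cases h : q ∈ D
    · obtain ⟨x, hx⟩ := h; exact ⟨x, fun _ => hx⟩
    · exact ⟨0, fun h' => absurd h' h⟩
  choose X hX using hex
  have hid : Tendsto (fun q : (ℝ × ℝ) × (ℝ × ℝ) => q) (𝓝[D] (y, z)) (𝓝 (y, z)) := nhdsWithin_le_nhds
  obtain ⟨x, h1, h2, -⟩ := P.lim (l := 𝓝[D] (y, z)) (X := X) (Y := Prod.fst) (Z := Prod.snd)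
    (continuous_fst.continuousAt.tendsto.comp hid) (continuous_snd.continuousAt.tendsto.comp hid)
    (eventually_nhdsWithin_of_forall hX)
  exact ⟨x, h1, h2⟩

/-- continuity of the bracket along continuous families -/
theorem br_cont (P : PS s u) {ι : Type*} [TopologicalSpace ι] {X Y Z : ι → ℝ × ℝ}
    (hY : Continuous Y) (hZ : Continuous Z) (h : ∀ i, s (X i) (Y i) ∧ u (X i) (Z i)) :
    Continuous X := by
  rw [continuous_iff_continuousAt]
  intro i
  obtain ⟨x, h1, h2, h3⟩ := P.lim (hY.tendsto i) (hZ.tendsto i) (Eventually.of_forall h)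
  have : X i = x := P.uniq (h i).1 (h i).2 h1 h2
  rw [ContinuousAt, this]; exact h3

theorem hol_trans (P : PS s u) {x y z} (h : Hol s x y) (h' : Hol s y z) : Hol s x z := by
  intro N hN
  filter_upwards [h _ (h' N hN)] with a ha
  obtain ⟨b, ⟨c, hc, hbc⟩, hab⟩ := ha
  exact ⟨c, hc, P.strans hab hbc⟩

theorem hol_chart {h : ℝ × ℝ → ℝ × ℝ} (hc : Continuous h)
    (ho : IsOpenMap h) (hs : ∀ q r, s (h q) (h r) ↔ q.1 = r.1) {q r} (e : s (h q) (h r)) :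
    Hol s (h q) (h r) := by
  intro N hN
  have e' := (hs q r).1 e
  have c : Continuous (fun q' : ℝ × ℝ => h (q'.1, r.2)) :=
    hc.comp (continuous_fst.prodMk continuous_const)
  have h1 : {q' : ℝ × ℝ | h (q'.1, r.2) ∈ N} ∈ 𝓝 q := by
    apply c.continuousAt
    simp only [e']
    exact hN
  filter_upwards [ho.image_mem_nhds h1]
  rintro _ ⟨q', hq', rfl⟩
  exact ⟨_, hq', (hs _ _).2 rfl⟩

theorem hol_path (P : PS s u) {γ : unitInterval → ℝ × ℝ} (hγ : Continuous γ)
    (h : ∀ i j, s (γ i) (γ j)) (i j) : Hol s (γ i) (γ j) := by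
  refine PreconnectedSpace.induction₂' (fun i j => Hol s (γ i) (γ j)) ?_
    ⟨fun a b c h1 h2 => P.hol_trans h1 h2⟩ i j
  intro i
  obtain ⟨c, hc, hi, ho, hp, hs, hu⟩ := P.chart (γ i)
  have : ∀ᶠ j in 𝓝 i, γ j ∈ range c := hγ.continuousAt (ho.isOpen_range.mem_nhds hp)
  obtain ⟨q, hq⟩ := hp
  filter_upwards [this]
  rintro j ⟨r, hr⟩
  rw [← hq, ← hr]
  exact ⟨hol_chart hc ho hs (by rw [hq, hr]; exact h _ _),
    hol_chart hc ho hs (by rw [hq, hr]; exact h _ _)⟩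

theorem D_nhds (P : PS s u) {x y z} (h1 : Hol s y x) (h2 : Hol u z x) :
    ∀ᶠ q : (ℝ × ℝ) × (ℝ × ℝ) in 𝓝 (y, z), ∃ x, s x q.1 ∧ u x q.2 := by
  obtain ⟨c, hc, hi, ho, hp, hs, hu⟩ := P.chart x
  have hO := ho.isOpen_range.mem_nhds hp
  filter_upwards [prod_mem_nhds (h1 _ hO) (h2 _ hO)]
  rintro ⟨y', z'⟩ ⟨⟨_, ⟨q, rfl⟩, hq⟩, ⟨_, ⟨r, rfl⟩, hr⟩⟩
  exact ⟨c (q.1, r.2), P.strans ((hs (q.1, r.2) q).2 rfl) (P.ssymm hq),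
    P.utrans ((hu (q.1, r.2) r).2 rfl) (P.usymm hr)⟩

theorem rect (P : PS s u) {w z : unitInterval → ℝ × ℝ} (hw : Continuous w) (hz : Continuous z)
    (h0 : w 0 = z 0) (hu : ∀ i j, u (w i) (w j)) (hs : ∀ i j, s (z i) (z j)) (r t) :
    ∃ x, s x (w r) ∧ u x (z t) := by
  set S0 : Set unitInterval := {t | ∀ r, ∃ x, s x (w r) ∧ u x (z t)} with hS0
  have cS0 : IsClosed S0 := by
    simp only [hS0, ofPred_forall]
    refine isClosed_iInter fun r => ?_
    exact P.D_closed.preimage (f := fun t => (w r, z t)) (continuous_const.prodMk hz)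
  set S : Set unitInterval := {t | ∀ a, min a t ∈ S0} with hS
  have cS : IsClosed S := by
    simp only [hS, ofPred_forall]
    exact isClosed_iInter fun a => cS0.preimage (continuous_const.min continuous_id)
  have zS : (0 : unitInterval) ∈ S := by
    intro a r
    rw [min_eq_right (unitInterval.nonneg' (t := a))]
    exact ⟨w r, P.srefl _, h0 ▸ hu _ _⟩
  have nS0 : ∀ t ∈ S, S0 ∈ 𝓝 t := by
    intro t ht
    choose φ hφs hφu using ht
    have e0 : ∀ a r, min a t = 0 → φ a r = w r := by
      intro a r e
      refine P.uniq (hφs a r) (hφu a r) (P.srefl _) ?_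
      rw [e, ← h0]; exact hu _ _
    have key : ∀ r, ∀ᶠ q : (ℝ × ℝ) × (ℝ × ℝ) in 𝓝 (w r, z t), ∃ x, s x q.1 ∧ u x q.2 := by
      intro r
      have c1 : Continuous (fun a => φ a r) :=
        P.br_cont (Y := fun _ => w r) (Z := fun a => z (min a t)) continuous_const
          (hz.comp (continuous_id.min continuous_const)) fun a => ⟨hφs a r, hφu a r⟩
      have c2 : Continuous (fun r => φ 1 r) :=
        P.br_cont (Y := w) (Z := fun _ => z (min 1 t)) hw continuous_const
          fun r => ⟨hφs 1 r, hφu 1 r⟩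
      have e1 : φ 0 r = w r := e0 0 r (min_eq_left (unitInterval.nonneg'))
      have e2 : φ 1 0 = z t := by
        have hm : min 1 t = t := min_eq_right (unitInterval.le_one')
        refine P.uniq (hφs 1 0) (hφu 1 0) ?_ ?_
        · rw [h0]; exact hs _ _
        · rw [hm]; exact P.urefl _
      have H1 : Hol s (w r) (φ 1 r) := by
        rw [← e1]
        exact P.hol_path c1 (fun i j => P.strans (hφs i r) (P.ssymm (hφs j r))) 0 1
      have H2 : Hol u (z t) (φ 1 r) := by
        rw [← e2]
        exact P.swap.hol_path c2 (fun i j => P.utrans (hφu 1 i) (P.usymm (hφu 1 j))) 0 r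
      exact P.D_nhds H1 H2
    have := isCompact_univ.eventually_forall_of_forall_eventually (x₀ := t)
      (K := (univ : Set unitInterval)) (P := fun t r => ∃ x, s x (w r) ∧ u x (z t)) (by
        intro r _
        have cc : Continuous (fun q : unitInterval × unitInterval => (w q.2, z q.1)) :=
          (hw.comp continuous_snd).prodMk (hz.comp continuous_fst)
        exact (cc.tendsto (t, r)).eventually (key r))
    filter_upwards [this] with t' ht' r
    exact ht' r (mem_univ _)
  have oS : IsOpen S := by
    rw [isOpen_iff_mem_nhds]
    intro t ht
    obtain ⟨ε, hε, hb⟩ := Metric.mem_nhds_iff.1 (nS0 t ht)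
    filter_upwards [Metric.ball_mem_nhds t hε] with τ hτ a
    rcases le_total (min a τ) t with h | h
    · have := ht (min a τ)
      rwa [min_eq_left h] at this
    · apply hb
      rw [Metric.mem_ball, Subtype.dist_eq, Real.dist_eq] at hτ ⊢
      have h1 : (t : ℝ) ≤ (min a τ : unitInterval) := h
      have h2 : ((min a τ : unitInterval) : ℝ) ≤ τ := min_le_right a τ
      rw [abs_of_nonneg (by linarith)]
      rw [abs_of_nonneg (by linarith)] at hτ
      linarith
  have hSu : S = univ := IsClopen.eq_univ ⟨cS, oS⟩ ⟨0, zS⟩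
  have : t ∈ S := hSu ▸ mem_univ t
  have := this t r
  rwa [min_self] at this

theorem joined_symm (P : PS s u) {a b} (h : JoinedIn {x | s a x} a b) :
    JoinedIn {x | s b x} b a :=
  h.symm.mono fun _ hx => P.strans (P.ssymm h.target_mem) hx

theorem joined_trans (P : PS s u) {a b c} (h : JoinedIn {x | s a x} a b)
    (h' : JoinedIn {x | s b x} b c) : JoinedIn {x | s a x} a c :=
  h.trans (h'.mono fun _ hx => P.strans h.target_mem hx)

theorem comm (P : PS s u) {o a b} (h : JoinedIn {x | u o x} o a) (h' : JoinedIn {x | s o x} o b) :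
    ∃ x, JoinedIn {x | s a x} a x ∧ JoinedIn {x | u b x} b x := by
  obtain ⟨w, hw⟩ := h
  obtain ⟨z, hz⟩ := h'
  have hw' : ∀ i j, u (w i) (w j) := fun i j => P.utrans (P.usymm (hw i)) (hw j)
  have hz' : ∀ i j, s (z i) (z j) := fun i j => P.strans (P.ssymm (hz i)) (hz j)
  have := P.rect w.continuous z.continuous (by simp) hw' hz'
  choose φ hφs hφu using this
  have c1 : Continuous (fun t => φ 1 t) :=
    P.br_cont (Y := fun _ => w 1) (Z := z) continuous_const z.continuous
      fun t => ⟨hφs 1 t, hφu 1 t⟩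
  have c2 : Continuous (fun r => φ r 1) :=
    P.br_cont (Y := w) (Z := fun _ => z 1) w.continuous continuous_const
      fun t => ⟨hφs t 1, hφu t 1⟩
  refine ⟨φ 1 1, ⟨⟨⟨fun t => φ 1 t, c1⟩, ?_, rfl⟩, fun t => ?_⟩,
    ⟨⟨⟨fun t => φ t 1, c2⟩, ?_, rfl⟩, fun t => ?_⟩⟩
  · refine P.uniq (hφs 1 0) (hφu 1 0) (by simpa using P.srefl a) ?_
    have := hw' 1 0
    simpa using this
  · have := P.ssymm (hφs 1 t)
    simpa using this
  · refine P.uniq (hφs 0 1) (hφu 0 1) ?_ (by simpa using P.urefl b)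
    have := hz' 1 0
    simpa using this
  · have := P.usymm (hφu t 1)
    simpa using this

theorem joined_chart {h : ℝ × ℝ → ℝ × ℝ} (hc : Continuous h)
    (hs : ∀ q r, s (h q) (h r) ↔ q.1 = r.1) (q r : ℝ × ℝ) (e : q.1 = r.1) :
    JoinedIn {x | s (h q) x} (h q) (h r) := by
  refine JoinedIn.ofLine (f := fun t => h (q.1, (1 - t) * q.2 + t * r.2)) ?_ (by simp)
    (by simp [e]) ?_
  · exact (hc.comp (by fun_prop)).continuousOn
  · rintro _ ⟨t, -, rfl⟩
    exact (hs _ _).2 rfl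

theorem all_meet (P : PS s u) (y z) :
    ∃ x, JoinedIn {x | s y x} y x ∧ JoinedIn {x | u x z} x z := by
  have flip : ∀ {a b}, JoinedIn {x | u a x} a b → JoinedIn {x | u x b} a b := by
    intro a b h
    exact h.mono fun x hx => P.utrans (P.usymm hx) h.target_mem
  have flip' : ∀ {a b}, JoinedIn {x | u x b} a b → JoinedIn {x | u a x} a b := by
    intro a b h
    exact h.mono fun x hx => P.utrans h.source_mem (P.usymm hx)
  refine PreconnectedSpace.induction₂'
    (fun y z => ∃ x, JoinedIn {x | s y x} y x ∧ JoinedIn {x | u x z} x z) ?_ ⟨?_⟩ y z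
  · intro p
    obtain ⟨c, hc, hi, ho, hp, hs, hu⟩ := P.chart p
    have hO := ho.isOpen_range.mem_nhds hp
    obtain ⟨q, rfl⟩ := hp
    have J : ∀ q r : ℝ × ℝ, ∃ x, JoinedIn {x | s (c q) x} (c q) x ∧
        JoinedIn {x | u x (c r)} x (c r) := by
      intro q r
      refine ⟨c (q.1, r.2), joined_chart hc hs q _ rfl, flip ?_⟩
      have := joined_chart (s := u) (h := c ∘ Prod.swap) (hc.comp continuous_swap)
        (fun q r => by simpa using hu q.swap r.swap) (r.2, q.1) r.swap rfl
      simpa using this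
    filter_upwards [hO]
    rintro _ ⟨r, rfl⟩
    exact ⟨J q r, J r q⟩
  · rintro a b c ⟨x, h1, h2⟩ ⟨x', h3, h4⟩
    obtain ⟨v, h5, h6⟩ := P.comm (P.swap.joined_symm (flip' h2)) h3
    exact ⟨v, P.joined_trans h1 h5, flip (P.swap.joined_trans (P.swap.joined_symm h6) (flip' h4))⟩

theorem bracket (P : PS s u) : ∃ br : (ℝ × ℝ) × (ℝ × ℝ) → ℝ × ℝ, Continuous br ∧
    ∀ q, s (br q) q.1 ∧ u (br q) q.2 := by
  have : ∀ q : (ℝ × ℝ) × (ℝ × ℝ), ∃ x, s x q.1 ∧ u x q.2 := by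
    intro q
    obtain ⟨x, h1, h2⟩ := P.all_meet q.1 q.2
    exact ⟨x, P.ssymm h1.target_mem, h2.source_mem⟩
  choose br h using this
  exact ⟨br, P.br_cont continuous_fst continuous_snd h, h⟩

end PS

/-! ### One-dimensional contractions -/

theorem oi_succ (e : ℝ ≃o ℝ) (n : ℤ) (t : ℝ) : (e ^ (n + 1)) t = e ((e ^ n) t) := by
  rw [add_comm, zpow_add]; simp

theorem oi_add (e : ℝ ≃o ℝ) (m n : ℤ) (t : ℝ) : (e ^ (m + n)) t = (e ^ m) ((e ^ n) t) := by
  rw [zpow_add]; simp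

theorem oi_zero (e : ℝ ≃o ℝ) (h0 : e 0 = 0) (n : ℤ) : (e ^ n) 0 = 0 := by
  have hi : e.symm 0 = 0 := by rw [OrderIso.symm_apply_eq, h0]
  induction n with
  | zero => simp
  | succ n ih => rw [oi_succ, ih, h0]
  | pred n ih =>
    have := oi_succ e (-(n : ℤ) - 1) 0
    rw [sub_add_cancel, ih] at this
    rw [← hi, ← e.symm_apply_apply ((e ^ (-(n : ℤ) - 1)) (e.symm 0)), hi, ← this, hi]

/-- positive orbits tend to zero -/
theorem oi_tendsto_pos (e : ℝ ≃o ℝ) (h0 : e 0 = 0) (hp : ∀ t, 0 < t → e t < t) {t : ℝ}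
    (ht : 0 < t) : Tendsto (fun n : ℕ => (e ^ (n : ℤ)) t) atTop (𝓝 0) := by
  have hpos : ∀ n : ℤ, 0 < (e ^ n) t := by
    intro n
    rw [← oi_zero e h0 n]
    exact (e ^ n).strictMono ht
  have hanti : Antitone (fun n : ℕ => (e ^ (n : ℤ)) t) := by
    refine antitone_nat_of_succ_le fun n => ?_
    push_cast
    rw [oi_succ]
    exact (hp _ (hpos n)).le
  have hlim := tendsto_atTop_ciInf hanti ⟨0, by rintro _ ⟨n, rfl⟩; exact (hpos n).le⟩
  set L := ⨅ n : ℕ, (e ^ (n : ℤ)) t with hL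
  have hL0 : 0 ≤ L := ge_of_tendsto' hlim fun n => (hpos n).le
  have h1 : Tendsto (fun n : ℕ => e ((e ^ (n : ℤ)) t)) atTop (𝓝 (e L)) :=
    (e.continuous.tendsto L).comp hlim
  have h2 : Tendsto (fun n : ℕ => e ((e ^ (n : ℤ)) t)) atTop (𝓝 L) := by
    refine (hlim.comp (tendsto_add_atTop_nat 1)).congr fun n => ?_
    simp only [Function.comp]
    push_cast
    rw [oi_succ]
  have h3 := tendsto_nhds_unique h1 h2
  rcases hL0.eq_or_lt with h | h
  · rw [h]; exact hlim
  · exact absurd h3 (hp L h).ne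

theorem oi_fund_pos (e : ℝ ≃o ℝ) (h0 : e 0 = 0) (hp : ∀ t, 0 < t → e t < t) {t : ℝ}
    (ht : 0 < t) : ∃ n : ℤ, e 1 < (e ^ n) t ∧ (e ^ n) t ≤ 1 := by
  have hpos : ∀ n : ℤ, 0 < (e ^ n) t := by
    intro n
    rw [← oi_zero e h0 n]
    exact (e ^ n).strictMono ht
  have hanti : Antitone (fun n : ℤ => (e ^ n) t) := by
    refine antitone_int_of_succ_le fun n => ?_
    rw [oi_succ]
    exact (hp _ (hpos n)).le
  have hne : ∃ n : ℤ, (e ^ n) t ≤ 1 := by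
    obtain ⟨n, hn⟩ := ((oi_tendsto_pos e h0 hp ht).eventually (gt_mem_nhds one_pos)).exists
    exact ⟨n, hn.le⟩
  have hbd : ∃ b : ℤ, ∀ z : ℤ, (e ^ z) t ≤ 1 → b ≤ z := by
    obtain ⟨n, hn⟩ := ((oi_tendsto_pos e h0 hp one_pos).eventually (gt_mem_nhds ht)).exists
    refine ⟨-n, fun z hz => ?_⟩
    by_contra hc
    push Not at hc
    have h1 := hanti hc.le
    have h2 : (e ^ (-(n : ℤ))) ((e ^ (n : ℤ)) 1) < (e ^ (-(n : ℤ))) t :=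
      (e ^ (-(n : ℤ))).strictMono hn
    rw [← oi_add, neg_add_cancel] at h2
    simp only [zpow_zero, RelIso.one_apply] at h2
    simp only at h1
    linarith
  obtain ⟨n, hn, hmin⟩ := Int.exists_least_of_bdd hbd hne
  refine ⟨n, ?_, hn⟩
  have h1 : 1 < (e ^ (n - 1)) t := by
    by_contra hc
    have := hmin (n - 1) (not_lt.1 hc)
    omega
  have := oi_succ e (n - 1) t
  rw [sub_add_cancel] at this
  rw [this]
  exact e.strictMono h1

/-- Conjugate by `t ↦ -t`. -/
def oiNeg (e : ℝ ≃o ℝ) : ℝ ≃o ℝ where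
  toFun t := -e (-t)
  invFun t := -e.symm (-t)
  left_inv t := by simp
  right_inv t := by simp
  map_rel_iff' := by intro a b; simp

theorem oiNeg_zpow (e : ℝ ≃o ℝ) (n : ℤ) (t : ℝ) : ((oiNeg e) ^ n) t = -(e ^ n) (-t) := by
  induction n generalizing t with
  | zero => simp
  | succ n ih => rw [oi_succ, oi_succ, ih]; simp [oiNeg]
  | pred n ih =>
    have h1 := oi_succ e (-(n : ℤ) - 1) (-t)
    have h2 := oi_succ (oiNeg e) (-(n : ℤ) - 1) t
    rw [sub_add_cancel] at h1 h2
    apply (oiNeg e).injective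
    rw [← h2, ih, h1]
    simp [oiNeg]

theorem lin_conj (e : ℝ ≃o ℝ) (h0 : e 0 = 0) (hp : ∀ t, 0 < t → e t < t)
    (hn : ∀ t, t < 0 → t < e t) : ∃ K : ℝ ≃ₜ ℝ, ∀ t, K (e t) = K t / 2 := by
  have h0' : oiNeg e 0 = 0 := by simp [oiNeg, h0]
  have hp' : ∀ t, 0 < t → oiNeg e t < t := by
    intro t ht
    have := hn (-t) (by linarith)
    simp only [oiNeg, RelIso.coe_fn_mk, Equiv.coe_fn_mk]
    linarith
  have htend : ∀ t, Tendsto (fun n : ℕ => (e ^ (n : ℤ)) t) atTop (𝓝 0) := by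
    intro t
    rcases lt_trichotomy t 0 with h | h | h
    · have := (oi_tendsto_pos (oiNeg e) h0' hp' (t := -t) (by linarith)).neg
      simpa only [oiNeg_zpow, neg_neg, neg_zero] using this
    · subst h; simp only [oi_zero e h0]; exact tendsto_const_nhds
    · exact oi_tendsto_pos e h0 hp h
  have hup : ∀ x, e x ≤ max x 0 := by
    intro x
    rcases lt_or_ge 0 x with h | h
    · exact (hp x h).le.trans (le_max_left _ _)
    · have := e.monotone h
      rw [h0] at this
      exact this.trans (le_max_right _ _)
  have hlo : ∀ x, min x 0 ≤ e x := by
    intro x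
    rcases lt_or_ge x 0 with h | h
    · exact (min_le_left _ _).trans (hn x h).le
    · have := e.monotone h
      rw [h0] at this
      exact (min_le_right _ _).trans this
  set p := e 1 with hpdef
  set q := e (-1) with hqdef
  have hp0 : 0 < p := by rw [hpdef, ← h0]; exact e.strictMono (by norm_num)
  have hq0 : q < 0 := by rw [hqdef, ← h0]; exact e.strictMono (by norm_num)
  set b : ℝ → ℝ := fun t => min (max (t - p) 0) 1 + max (min (t - q) 0) (-1) with hb
  have bmono : Monotone b := by
    intro x y hxy
    simp only [hb]
    gcongr
  have bcont : Continuous b := by simp only [hb]; fun_prop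
  have bbd : ∀ t, |b t| ≤ 2 := by
    intro t
    have h1 : min (max (t - p) 0) 1 ≤ 1 := min_le_right _ _
    have h2 : 0 ≤ min (max (t - p) 0) 1 := le_min (le_max_right _ _) zero_le_one
    have h3 : -1 ≤ max (min (t - q) 0) (-1) := le_max_right _ _
    have h4 : max (min (t - q) 0) (-1) ≤ 0 := max_le (min_le_right _ _) (by norm_num)
    rw [abs_le]
    simp only [hb]
    constructor <;> linarith
  have bzero : ∀ t, q < t → t < p → b t = 0 := by
    intro t h1 h2
    simp only [hb]
    rw [max_eq_right (by linarith : t - p ≤ 0), min_eq_right (by linarith : 0 ≤ t - q)]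
    norm_num
  -- strictness
  have bstrict1 : ∀ s t, s < t → p < t → t ≤ 1 → b s < b t := by
    intro s t hst h1 h2
    simp only [hb]
    refine add_lt_add_of_lt_of_le ?_ (by gcongr)
    rw [min_eq_left (max_le (by linarith) zero_le_one : max (t - p) 0 ≤ 1),
      max_eq_left (by linarith : 0 ≤ t - p)]
    exact (min_le_left _ _).trans_lt (max_lt (by linarith) (by linarith))
  have bstrict2 : ∀ s t, s < t → s < q → -1 ≤ s → b s < b t := by
    intro s t hst h1 h2
    simp only [hb]
    refine add_lt_add_of_le_of_lt (by gcongr) ?_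
    rw [max_eq_left (le_min (by linarith) (by norm_num) : -1 ≤ min (s - q) 0),
      min_eq_left (by linarith : s - q ≤ 0)]
    exact (lt_min (by linarith) (by linarith)).trans_le (le_max_left _ _)
  -- the domains
  set A : ℕ → Set ℝ := fun m => {t | q < (e ^ (m : ℤ)) t ∧ (e ^ (m : ℤ)) t < p} with hA
  have Aopen : ∀ m, IsOpen (A m) := by
    intro m
    have := (e ^ (m : ℤ)).continuous
    exact (isOpen_lt continuous_const this).inter (isOpen_lt this continuous_const)
  have Acov : ∀ t, ∃ m, t ∈ A m := by
    intro t
    obtain ⟨m, hm⟩ := ((htend t).eventually (Ioo_mem_nhds hq0 hp0)).exists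
    exact ⟨m, hm.1, hm.2⟩
  have Astay : ∀ m t, t ∈ A m → ∀ k : ℕ, q < (e ^ ((m : ℤ) + k)) t ∧ (e ^ ((m : ℤ) + k)) t < p := by
    intro m t ht k
    induction k with
    | zero =>
      have ht2 : q < (e ^ (m:ℤ)) t ∧ (e ^ (m:ℤ)) t < p := ht
      simpa using ht2
    | succ k ih =>
      push_cast
      rw [← add_assoc, oi_succ]
      exact ⟨(lt_min ih.1 hq0).trans_le (hlo _), (hup _).trans_lt (max_lt ih.2 hp0)⟩
  have Azero : ∀ m t, t ∈ A m → ∀ n : ℤ, (m : ℤ) ≤ n → b ((e ^ n) t) = 0 := by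
    intro m t ht n hmn
    have := Astay m t ht (n - m).toNat
    rw [show (m : ℤ) + ((n - m).toNat : ℤ) = n by omega] at this
    exact bzero _ this.1 this.2
  set v : ℕ → ℤ → ℝ := fun m n => if n < (m : ℤ) then 2 ^ n * 2 else 0 with hv
  have vsum : ∀ m, Summable (v m) := by
    intro m
    refine Summable.of_nat_of_neg_add_one ?_ ?_
    · refine summable_of_ne_finset_zero (s := Finset.range m) fun n hn => ?_
      simp only [Finset.mem_range, not_lt] at hn
      simp only [hv]
      rw [if_neg (by exact_mod_cast not_lt.2 hn)]
    · have : ∀ n : ℕ, v m (-((n : ℤ) + 1)) = (1 / 2 : ℝ) ^ n := by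
        intro n
        simp only [hv]
        rw [if_pos (by omega), zpow_neg, zpow_add_one₀ (by norm_num), zpow_natCast]
        simp [mul_comm]
      simp only [this]
      exact summable_geometric_of_lt_one (by norm_num) (by norm_num)
  have vbd : ∀ m n, ∀ t ∈ A m, ‖(2 : ℝ) ^ n * b ((e ^ n) t)‖ ≤ v m n := by
    intro m n t ht
    simp only [hv]
    split_ifs with h
    · rw [norm_mul, Real.norm_eq_abs, Real.norm_eq_abs, abs_of_pos (by positivity)]
      have := bbd ((e ^ n) t)
      gcongr
    · rw [Azero m t ht n (not_lt.1 h)]; simp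
  have hsum : ∀ t, Summable (fun n : ℤ => (2 : ℝ) ^ n * b ((e ^ n) t)) := by
    intro t
    obtain ⟨m, hm⟩ := Acov t
    exact Summable.of_norm_bounded (vsum m) fun n => vbd m n t hm
  set H : ℝ → ℝ := fun t => ∑' n : ℤ, (2 : ℝ) ^ n * b ((e ^ n) t) with hH
  have Hcont : Continuous H := by
    rw [continuous_iff_continuousAt]
    intro t
    obtain ⟨m, hm⟩ := Acov t
    refine ContinuousOn.continuousAt (s := A m) ?_ ((Aopen m).mem_nhds hm)
    refine continuousOn_tsum (fun n => ?_) (vsum m) (vbd m)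
    exact (continuous_const.mul (bcont.comp (e ^ n).continuous)).continuousOn
  have Hconj : ∀ t, H (e t) = H t / 2 := by
    intro t
    simp only [hH]
    rw [← (Equiv.addRight (1 : ℤ)).tsum_eq (fun n : ℤ => (2 : ℝ) ^ n * b ((e ^ n) t)),
      ← tsum_div_const]
    refine tsum_congr fun n => ?_
    simp only [Equiv.coe_addRight]
    rw [zpow_add_one₀ (by norm_num), oi_add]
    simp only [zpow_one]
    ring
  have Hmono : StrictMono H := by
    intro s t hst
    have hle : (fun n : ℤ => (2 : ℝ) ^ n * b ((e ^ n) s)) ≤ fun n : ℤ => (2 : ℝ) ^ n * b ((e ^ n) t) := by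
      intro n
      have := bmono ((e ^ n).monotone hst.le)
      simp only
      gcongr
    have hlt : ∃ n : ℤ, b ((e ^ n) s) < b ((e ^ n) t) := by
      rcases lt_or_ge 0 t with h | h
      · obtain ⟨n, h1, h2⟩ := oi_fund_pos e h0 hp h
        exact ⟨n, bstrict1 _ _ ((e ^ n).strictMono hst) h1 h2⟩
      · obtain ⟨n, h1, h2⟩ := oi_fund_pos (oiNeg e) h0' hp' (t := -s) (by linarith)
        rw [oiNeg_zpow, neg_neg] at h1 h2
        refine ⟨n, bstrict2 _ _ ((e ^ n).strictMono hst) ?_ (by linarith)⟩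
        simp only [oiNeg, RelIso.coe_fn_mk, Equiv.coe_fn_mk] at h1
        rw [hqdef]; linarith
    obtain ⟨n, hn⟩ := hlt
    refine Summable.tsum_lt_tsum (i := n) hle ?_ (hsum s) (hsum t)
    have : (0 : ℝ) < 2 ^ n := by positivity
    exact mul_lt_mul_of_pos_left hn this
  have H0 : H 0 = 0 := by
    have := Hconj 0
    rw [h0] at this
    linarith
  have Hinv : ∀ (n : ℕ) t, H ((e ^ (-(n : ℤ))) t) = 2 ^ n * H t := by
    intro n t
    induction n with
    | zero => simp
    | succ n ih =>
      have h1 := oi_succ e (-((n + 1 : ℕ) : ℤ)) t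
      rw [show -((n + 1 : ℕ) : ℤ) + 1 = -(n : ℤ) by push_cast; ring] at h1
      have h2 := Hconj ((e ^ (-((n + 1 : ℕ) : ℤ))) t)
      rw [← h1, ih] at h2
      rw [pow_succ]; linarith
  have H1 : 0 < H 1 := by rw [← H0]; exact Hmono one_pos
  have H2 : H (-1) < 0 := by rw [← H0]; exact Hmono (by norm_num)
  have Hsurj : Function.Surjective H := by
    refine Hcont.surjective (Hmono.monotone.tendsto_atTop_atTop fun c => ?_)
      (Hmono.monotone.tendsto_atBot_atBot fun c => ?_)
    · obtain ⟨n, hn⟩ := pow_unbounded_of_one_lt (c / H 1) (one_lt_two : (1 : ℝ) < 2)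
      rw [div_lt_iff₀ H1] at hn
      exact ⟨_, (Hinv n 1).symm ▸ hn.le⟩
    · obtain ⟨n, hn⟩ := pow_unbounded_of_one_lt (c / H (-1)) (one_lt_two : (1 : ℝ) < 2)
      rw [div_lt_iff_of_neg H2] at hn
      exact ⟨_, (Hinv n (-1)).symm ▸ hn.le⟩
  exact ⟨(StrictMono.orderIsoOfSurjective H Hmono Hsurj).toHomeomorph, Hconj⟩

theorem sgn_lemma {φ w : ℝ → ℝ} {δ : ℝ} (hφ : ContinuousOn φ (Icc 0 δ)) (h0 : φ 0 = 0)
    (hw : Continuous w) (hw0 : ∀ t, t ≠ 0 → w 0 < w t)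
    (hlt : ∀ t ∈ Ioc 0 δ, w (φ t) < w t) : ∀ t ∈ Ioc 0 δ, φ t < t := by
  intro t ht
  by_contra hc
  push Not at hc
  obtain ⟨m, hm, hmax⟩ := (isCompact_Icc (a := (0:ℝ)) (b := t)).exists_isMaxOn
    ⟨0, le_refl _, ht.1.le⟩ hw.continuousOn
  have hm0 : m ≠ 0 := by
    rintro rfl
    have h1 := hmax (show t ∈ Icc 0 t from ⟨ht.1.le, le_refl _⟩)
    have h2 := hw0 t ht.1.ne'
    simp only [mem_ofPred_eq] at h1
    linarith
  have ivt := intermediate_value_Icc ht.1.le (hφ.mono (Icc_subset_Icc_right ht.2))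
  obtain ⟨s, hs, hsm⟩ := ivt (show m ∈ Icc (φ 0) (φ t) from ⟨by rw [h0]; exact hm.1, hm.2.trans hc⟩)
  have hs0 : s ≠ 0 := by
    rintro rfl
    exact hm0 (by rw [← hsm, h0])
  have h1 := hlt s ⟨lt_of_le_of_ne hs.1 hs0.symm, hs.2.trans ht.2⟩
  have h2 := hmax hs
  simp only [mem_ofPred_eq] at h2
  rw [hsm] at h1
  linarith

theorem extend_oi {φ : ℝ → ℝ} {δ : ℝ} (hδ : 0 < δ) (hφ : ContinuousOn φ (Icc (-δ) δ))
    (hm : StrictMonoOn φ (Icc (-δ) δ)) (hp : ∀ t ∈ Ioc 0 δ, φ t < t)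
    (hn : ∀ t ∈ Ico (-δ) 0, t < φ t) :
    ∃ e : ℝ ≃o ℝ, (∀ t ∈ Icc (-δ) δ, e t = φ t) ∧ (∀ t, 0 < t → e t < t) ∧
      (∀ t, t < 0 → t < e t) := by
  set k : ℝ → ℝ := fun t => max (-δ) (min δ t) with hk
  have kc : Continuous k := by fun_prop
  have kmem : ∀ t, k t ∈ Icc (-δ) δ := fun t =>
    ⟨le_max_left _ _, max_le (by linarith) (min_le_left _ _)⟩
  have kid : ∀ t ∈ Icc (-δ) δ, k t = t := fun t ht => by
    simp only [hk]; rw [min_eq_right ht.2, max_eq_right ht.1]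
  have kr : ∀ t, δ ≤ t → k t = δ := fun t ht => by
    simp only [hk]; rw [min_eq_left ht, max_eq_right (by linarith)]
  have kl : ∀ t, t ≤ -δ → k t = -δ := fun t ht => by
    simp only [hk]; rw [min_eq_right (by linarith), max_eq_left ht]
  set g : ℝ → ℝ := fun t => φ (k t) + (t - k t) / 2 with hg
  have gc : Continuous g := by
    have : Continuous (fun t => φ (k t)) := hφ.comp_continuous kc kmem
    exact this.add ((continuous_id.sub kc).div_const 2)
  have gm : StrictMono g := by
    intro s t hst
    have k1 : k s ≤ k t := max_le_max le_rfl (min_le_min le_rfl hst.le)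
    have k2 : k t - k s ≤ t - s := by
      rcases le_total t δ with h1 | h1 <;> rcases le_total s δ with h2 | h2 <;>
      rcases le_total (-δ) t with h3 | h3 <;> rcases le_total (-δ) s with h4 | h4 <;>
      simp only [hk, min_def, max_def] <;> split_ifs <;> linarith
    simp only [hg]
    rcases k1.lt_or_eq with h | h
    · have := hm (kmem s) (kmem t) h
      linarith
    · rw [h]; linarith
  have mmem : (-δ) ∈ Icc (-δ) δ := ⟨le_rfl, by linarith⟩
  have pmem : δ ∈ Icc (-δ) δ := ⟨by linarith, le_rfl⟩
  have gs : Function.Surjective g := by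
    refine gc.surjective ?_ ?_
    · refine tendsto_atTop_mono (f := fun t => φ (-δ) + (t - δ) / 2) ?_ ?_
      · intro t
        have h1 := hm.monotoneOn mmem (kmem t) (kmem t).1
        have h2 := (kmem t).2
        simp only [hg]; linarith
      · refine tendsto_atTop_add_const_left _ _ (Tendsto.atTop_div_const (by norm_num) ?_)
        exact tendsto_atTop_add_const_right _ _ tendsto_id
    · refine tendsto_atBot_mono (g := g) (f := fun t => φ δ + (t + δ) / 2) ?_ ?_
      · intro t
        have h1 := hm.monotoneOn (kmem t) pmem (kmem t).2
        have h2 := (kmem t).1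
        simp only [hg]; linarith
      · refine tendsto_atBot_add_const_left _ _ (Tendsto.atBot_div_const (by norm_num) ?_)
        exact tendsto_atBot_add_const_right _ _ tendsto_id
  refine ⟨gm.orderIsoOfSurjective g gs, ?_, ?_, ?_⟩
  · intro t ht
    change φ (k t) + (t - k t) / 2 = φ t
    rw [kid t ht]; ring
  · intro t ht
    change φ (k t) + (t - k t) / 2 < t
    rcases le_total t δ with h | h
    · rw [kid t ⟨by linarith, h⟩]; have := hp t ⟨ht, h⟩; linarith
    · rw [kr t h]; have := hp δ ⟨hδ, le_rfl⟩; linarith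
  · intro t ht
    change t < φ (k t) + (t - k t) / 2
    rcases le_total (-δ) t with h | h
    · rw [kid t ⟨h, by linarith⟩]; have := hn t ⟨h, ht⟩; linarith
    · rw [kl t h]; have := hn (-δ) ⟨le_rfl, by linarith⟩; linarith

theorem oi_iter_tendsto (e : ℝ ≃o ℝ) (h0 : e 0 = 0) (hp : ∀ t, 0 < t → e t < t)
    (hn : ∀ t, t < 0 → t < e t) (t : ℝ) : Tendsto (fun n => e^[n] t) atTop (𝓝 0) := by
  have fin : ∀ l, Tendsto (fun n => e^[n] t) atTop (𝓝 l) → l = 0 := by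
    intro l hl
    have : e l = l := isFixedPt_of_tendsto_iterate hl e.continuous.continuousAt
    rcases lt_trichotomy l 0 with h | h | h
    · have := hn l h; linarith
    · exact h
    · have := hp l h; linarith
  rcases le_total 0 t with ht | ht
  · have pos : ∀ n, 0 ≤ e^[n] t := by
      intro n
      induction n with
      | zero => exact ht
      | succ n ih => rw [Function.iterate_succ_apply', ← h0]; exact e.monotone ih
    have anti : Antitone (fun n => e^[n] t) := by
      refine antitone_nat_of_succ_le fun n => ?_
      rw [Function.iterate_succ_apply']
      rcases (pos n).lt_or_eq with h | h
      · exact (hp _ h).le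
      · rw [← h, h0]
    have := tendsto_atTop_ciInf anti ⟨0, by rintro _ ⟨n, rfl⟩; exact pos n⟩
    rwa [fin _ this] at this
  · have neg : ∀ n, e^[n] t ≤ 0 := by
      intro n
      induction n with
      | zero => exact ht
      | succ n ih =>
        rw [Function.iterate_succ_apply']
        have := e.monotone ih
        rwa [h0] at this
    have mono : Monotone (fun n => e^[n] t) := by
      refine monotone_nat_of_le_succ fun n => ?_
      rw [Function.iterate_succ_apply']
      rcases (neg n).lt_or_eq with h | h
      · exact (hn _ h).le
      · rw [h, h0]
    have := tendsto_atTop_ciSup mono ⟨0, by rintro _ ⟨n, rfl⟩; exact neg n⟩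
    rwa [fin _ this] at this

theorem isOpenMap_iter {X : Type*} [TopologicalSpace X] {F : X → X} (h : IsOpenMap F) (n : ℕ) :
    IsOpenMap F^[n] := by
  induction n with
  | zero => exact IsOpenMap.id
  | succ n ih => rw [Function.iterate_succ]; exact ih.comp h

theorem spread {X : Type*} [TopologicalSpace X] (F : X ≃ₜ X) (c : ℝ → X)
    (cc : Continuous c) (ci : Function.Injective c) (co : IsOpenMap c) {δ : ℝ} (hδ : 0 < δ)
    (e : ℝ ≃o ℝ) (h0 : e 0 = 0) (hp : ∀ t, 0 < t → e t < t) (hn : ∀ t, t < 0 → t < e t)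
    (hF : ∀ t ∈ Ioo (-δ) δ, F (c t) = c (e t))
    (hx : ∀ x, Tendsto (fun n => F^[n] x) atTop (𝓝 (c 0))) : ∃ H : X ≃ₜ ℝ, H (c 0) = 0 := by
  have stay : ∀ t ∈ Ioo (-δ) δ, e t ∈ Ioo (-δ) δ := by
    intro t ht
    rcases lt_trichotomy t 0 with h | h | h
    · have h1 := hn t h
      have h2 : e t < e 0 := e.strictMono h
      rw [h0] at h2
      exact ⟨by linarith [ht.1], by linarith⟩
    · rw [h, h0]; exact ⟨by linarith, hδ⟩
    · have h1 := hp t h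
      have h2 : e 0 < e t := e.strictMono h
      rw [h0] at h2
      exact ⟨by linarith [ht.1], by linarith [ht.2]⟩
  have ev : ∀ r, ∃ n : ℕ, e^[n] r ∈ Ioo (-δ) δ := fun r =>
    ((oi_iter_tendsto e h0 hp hn r).eventually (Ioo_mem_nhds (by linarith) hδ)).exists
  have stayn : ∀ r (n k : ℕ), e^[n] r ∈ Ioo (-δ) δ → e^[n + k] r ∈ Ioo (-δ) δ := by
    intro r n k h
    induction k with
    | zero => exact h
    | succ k ih => rw [← add_assoc, Function.iterate_succ_apply']; exact stay _ ih
  have wd : ∀ r (n k : ℕ), e^[n] r ∈ Ioo (-δ) δ →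
      F.symm^[n + k] (c (e^[n + k] r)) = F.symm^[n] (c (e^[n] r)) := by
    intro r n k h
    induction k with
    | zero => rfl
    | succ k ih =>
      rw [← add_assoc, Function.iterate_succ_apply, Function.iterate_succ_apply' e,
        ← hF _ (stayn r n k h), F.symm_apply_apply, ih]
  choose N hN using ev
  set Φ : ℝ → X := fun r => F.symm^[N r] (c (e^[N r] r)) with hΦ
  have Φeq : ∀ r n, e^[n] r ∈ Ioo (-δ) δ → Φ r = F.symm^[n] (c (e^[n] r)) := by
    intro r n h
    have h1 := wd r n (N r) h
    have h2 := wd r (N r) n (hN r)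
    rw [add_comm] at h2
    exact h2.symm.trans h1
  have loc : ∀ r, ∀ᶠ s in 𝓝 r, Φ s = F.symm^[N r] (c (e^[N r] s)) := by
    intro r
    have := (e.continuous.iterate (N r)).continuousAt.eventually (isOpen_Ioo.mem_nhds (hN r))
    filter_upwards [this] with s hs using Φeq s _ hs
  have Φc : Continuous Φ := by
    rw [continuous_iff_continuousAt]
    intro r
    have : ContinuousAt (fun s => F.symm^[N r] (c (e^[N r] s))) r :=
      ((F.symm.continuous.iterate _).comp (cc.comp (e.continuous.iterate _))).continuousAt
    exact this.congr ((loc r).mono fun s hs => hs.symm)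
  have Φo : IsOpenMap Φ := by
    rw [isOpenMap_iff_nhds_le]
    intro r
    have : IsOpenMap (fun s => F.symm^[N r] (c (e^[N r] s))) :=
      (isOpenMap_iter F.symm.isOpenMap _).comp (co.comp (isOpenMap_iter e.toHomeomorph.isOpenMap _))
    have h := this.nhds_le r
    rw [Filter.map_congr (loc r)]
    exact h
  have FF : ∀ n x, F.symm^[n] (F^[n] x) = x := fun n =>
    Function.LeftInverse.iterate (f := F) (g := F.symm) F.symm_apply_apply n
  have ee : ∀ n x, e^[n] (e.symm^[n] x) = x := fun n =>
    Function.LeftInverse.iterate (f := e.symm) (g := e) e.apply_symm_apply n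
  have Φi : Function.Injective Φ := by
    intro r s hrs
    rw [Φeq r (N r + N s) (stayn r _ _ (hN r)),
      Φeq s (N r + N s) (by rw [add_comm]; exact stayn s _ _ (hN s))] at hrs
    exact e.injective.iterate _ (ci (F.symm.injective.iterate _ hrs))
  have Φs : Function.Surjective Φ := by
    intro x
    have : c '' Ioo (-δ) δ ∈ 𝓝 (c 0) :=
      co.image_mem_nhds (Ioo_mem_nhds (by linarith) hδ)
    obtain ⟨n, t, ht, htn⟩ := ((hx x).eventually this).exists
    refine ⟨e.symm^[n] t, ?_⟩
    rw [Φeq _ n (by rw [ee]; exact ht), ee, htn, FF]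
  have Φ0 : Φ 0 = c 0 := by
    rw [Φeq 0 0 ⟨by simpa using hδ, hδ⟩]; rfl
  let E : ℝ ≃ₜ X := (Equiv.ofBijective Φ ⟨Φi, Φs⟩).toHomeomorphOfContinuousOpen Φc Φo
  refine ⟨E.symm, ?_⟩
  rw [← Φ0]
  exact E.symm_apply_apply 0

theorem line_lemma {X : Type*} [TopologicalSpace X] (G : X ≃ₜ X) (c : ℝ → X)
    (cc : Continuous c) (ci : Function.Injective c) (co : IsOpenMap c)
    (hG : G (c 0) = c 0) (v : X → ℝ) (hv : Continuous v) (hv0 : ∀ x, x ≠ c 0 → v (c 0) < v x)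
    (hvG : ∀ x, x ≠ c 0 → v (G x) < v x)
    (hx : ∀ x, Tendsto (fun n => G^[n] x) atTop (𝓝 (c 0))) : ∃ H : X ≃ₜ ℝ, H (c 0) = 0 := by
  have emb : IsOpenEmbedding c := IsOpenEmbedding.of_continuous_injective_isOpenMap cc ci co
  set g : X → ℝ := fun x => Function.invFun c x with hg
  have cg : ∀ x ∈ range c, c (g x) = x := fun x hx => Function.invFun_eq hx
  have gcn : ∀ x ∈ range c, ContinuousAt g x := by
    rintro _ ⟨t, rfl⟩
    rw [ContinuousAt, ← emb.map_nhds_eq, tendsto_map'_iff]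
    have : g ∘ c = id := by funext s; exact Function.leftInverse_invFun ci s
    rw [this, show g (c t) = t from Function.leftInverse_invFun ci t]
    exact tendsto_id
  set O : Set ℝ := {t | G (c t) ∈ range c} with hO
  have Oo : IsOpen O := co.isOpen_range.preimage (G.continuous.comp cc)
  have O0 : (0:ℝ) ∈ O := ⟨0, hG.symm⟩
  set φ : ℝ → ℝ := fun t => g (G (c t)) with hφ
  have cφ : ∀ t ∈ O, c (φ t) = G (c t) := fun t ht => cg _ ht
  have φc : ContinuousOn φ O := fun t ht =>
    ((gcn _ ht).comp (f := fun t => G (c t)) (G.continuous.comp cc).continuousAt).continuousWithinAt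
  have φi : InjOn φ O := by
    intro s hs t ht h
    have : c (φ s) = c (φ t) := by rw [h]
    rw [cφ s hs, cφ t ht] at this
    exact ci (G.injective this)
  have φ0 : φ 0 = 0 := ci (by rw [cφ 0 O0, hG])
  obtain ⟨δ₀, hδ₀, hO'⟩ := Metric.nhds_basis_closedBall.mem_iff.1 (Oo.mem_nhds O0)
  rw [Real.closedBall_eq_Icc, zero_sub, zero_add] at hO'
  have hpre : {t | φ t ∈ Icc (-δ₀) δ₀} ∈ 𝓝 (0:ℝ) := by
    have : ContinuousAt φ 0 := φc.continuousAt (Oo.mem_nhds O0)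
    refine this (?_ : Icc (-δ₀) δ₀ ∈ 𝓝 (φ 0))
    rw [φ0]; exact Icc_mem_nhds (by linarith) hδ₀
  obtain ⟨δ₁, hδ₁, hI⟩ := Metric.nhds_basis_closedBall.mem_iff.1 hpre
  rw [Real.closedBall_eq_Icc, zero_sub, zero_add] at hI
  set δ := min δ₀ δ₁ with hδd
  have hδ : 0 < δ := lt_min hδ₀ hδ₁
  have sub0 : Icc (-δ) δ ⊆ Icc (-δ₀) δ₀ :=
    Icc_subset_Icc (neg_le_neg (min_le_left _ _)) (min_le_left _ _)
  have maps : MapsTo φ (Icc (-δ) δ) (Icc (-δ₀) δ₀) := fun t ht =>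
    hI (Icc_subset_Icc (neg_le_neg (min_le_right _ _)) (min_le_right _ _) ht)
  have ψc : ContinuousOn (fun t => φ (φ t)) (Icc (-δ) δ) :=
    (φc.mono hO').comp (φc.mono (sub0.trans hO')) maps
  have ψm : StrictMonoOn (fun t => φ (φ t)) (Icc (-δ) δ) := by
    rcases ContinuousOn.strictMonoOn_of_injOn_Icc' (by linarith) (φc.mono hO') (φi.mono hO')
      with h | h
    · exact h.comp (h.mono sub0) maps
    · exact h.comp (h.mono sub0) maps
  have cψ : ∀ t ∈ Icc (-δ) δ, c (φ (φ t)) = G (G (c t)) := by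
    intro t ht
    rw [cφ _ (hO' (maps ht)), cφ _ (hO' (sub0 ht))]
  have wlt : ∀ t ∈ Icc (-δ) δ, t ≠ 0 → v (c (φ (φ t))) < v (c t) := by
    intro t ht h
    rw [cψ t ht]
    have h1 : c t ≠ c 0 := fun h' => h (ci h')
    have h2 : G (c t) ≠ c 0 := fun h' => h1 (G.injective (h'.trans hG.symm))
    exact (hvG _ h2).trans (hvG _ h1)
  have ψ0 : φ (φ 0) = 0 := by rw [φ0, φ0]
  have sp : ∀ t ∈ Ioc 0 δ, φ (φ t) < t :=
    sgn_lemma (φ := fun t => φ (φ t)) (w := fun t => v (c t))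
      (ψc.mono (Icc_subset_Icc_left (by linarith))) ψ0 (hv.comp cc)
      (fun t ht => hv0 _ fun h => ht (ci h))
      (fun t ht => wlt t ⟨by linarith [ht.1], ht.2⟩ ht.1.ne')
  have sn : ∀ t ∈ Ioc 0 δ, - φ (φ (-t)) < t := by
    refine sgn_lemma (φ := fun t => - φ (φ (-t))) (w := fun t => v (c (-t))) ?_ ?_ ?_ ?_ ?_
    · refine (ψc.comp (f := fun t => -t) continuous_neg.continuousOn ?_).neg
      intro t ht
      exact ⟨neg_le_neg ht.2, by linarith [ht.1]⟩
    · simp [ψ0]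
    · exact hv.comp (cc.comp continuous_neg)
    · intro t ht
      simp only [neg_zero]
      exact hv0 _ fun h => ht (by simpa using ci h)
    · intro t ht
      simp only [neg_neg]
      exact wlt (-t) ⟨neg_le_neg ht.2, by linarith [ht.1]⟩ (by linarith [ht.1])
  obtain ⟨e, he, hp, hn⟩ := extend_oi hδ ψc ψm sp (by
    intro t ht
    have := sn (-t) ⟨by linarith [ht.2], by linarith [ht.1]⟩
    rw [neg_neg] at this
    linarith)
  have e0 : e 0 = 0 := by rw [he 0 ⟨by linarith, hδ.le⟩]; exact ψ0
  refine spread (G.trans G) c cc ci co hδ e e0 hp hn ?_ ?_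
  · intro t ht
    have ht' := Ioo_subset_Icc_self ht
    rw [he t ht', cψ t ht']; rfl
  · intro x
    have h1 : ∀ n, (G.trans G)^[n] x = G^[2 * n] x := by
      intro n
      rw [Function.iterate_mul]; rfl
    simp only [h1]
    exact (hx x).comp (tendsto_id.const_mul_atTop' (by norm_num))

theorem Rs.map {f U x y} (h : Rs f U x y) : Rs f U (f x) (f y) := by
  simpa using h.iter 1

theorem Rs.map_inv {f U x y} (h : Rs f U x y) : Rs f U (f⁻¹ x) (f⁻¹ y) := by
  simpa using h.iter (-1)

/-- The map `f` restricted to the stable leaf of a fixed point. -/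
def leafG {f U} (S : Sys f U) {p : ℝ × ℝ} (hp : f p = p) :
    {x // Rs f U p x} ≃ₜ {x // Rs f U p x} where
  toFun x := ⟨f x.1, by have := x.2.map; rwa [hp] at this⟩
  invFun x := ⟨f⁻¹ x.1, by
    have := x.2.map_inv
    rwa [show f⁻¹ p = p from by rw [Equiv.Perm.inv_eq_iff_eq, hp]] at this⟩
  left_inv x := by simp
  right_inv x := by simp
  continuous_toFun := (S.cf.comp continuous_subtype_val).subtype_mk _
  continuous_invFun := (S.cf'.comp continuous_subtype_val).subtype_mk _

theorem leafG_iter {f U} (S : Sys f U) {p : ℝ × ℝ} (hp : f p = p) (x : {x // Rs f U p x}) (n : ℕ) :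
    ((leafG S hp)^[n] x).1 = (f ^ (n : ℤ)) x.1 := by
  induction n with
  | zero => rfl
  | succ n ih =>
    rw [Function.iterate_succ_apply']
    push_cast
    rw [zpow_succ_apply, ← ih]; rfl

theorem leafG_tendsto {f U} (S : Sys f U) {p : ℝ × ℝ} (hp : f p = p) (x : {x // Rs f U p x}) :
    Tendsto (fun n => (leafG S hp)^[n] x) atTop (𝓝 ⟨p, S.refl p⟩) := by
  rw [tendsto_subtype_rng]
  simp only [leafG_iter]
  exact S.contract hp x.2

theorem leaf_line {f U} (S : Sys f U) {p : ℝ × ℝ} (hp : f p = p) :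
    ∃ H : {x // Rs f U p x} ≃ₜ ℝ, H ⟨p, S.refl p⟩ = 0 := by
  obtain ⟨h, hc, hi, ho, ⟨⟨a, b⟩, hab⟩, hs, -⟩ := S.chart p
  have hm : ∀ t, Rs f U p (h (a, b + t)) := fun t => by
    rw [← hab, hs]
  set c : ℝ → {x // Rs f U p x} := fun t => ⟨h (a, b + t), hm t⟩ with hcd
  have c0 : c 0 = ⟨p, S.refl p⟩ := by
    simp only [hcd, add_zero]; exact Subtype.ext hab
  have cc : Continuous c :=
    Continuous.subtype_mk (hc.comp (continuous_const.prodMk (continuous_const.add continuous_id))) _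
  have ci : Function.Injective c := by
    intro s t hst
    have := hi (Subtype.ext_iff.1 hst)
    simpa using this
  have co : IsOpenMap c := by
    intro V hV
    have hO : IsOpen (h '' {q : ℝ × ℝ | q.2 - b ∈ V}) :=
      ho _ (hV.preimage (continuous_snd.sub continuous_const))
    convert hO.preimage (continuous_subtype_val (p := fun x => Rs f U p x)) using 1
    ext x
    constructor
    · rintro ⟨t, ht, rfl⟩
      exact ⟨(a, b + t), by simpa using ht, rfl⟩
    · rintro ⟨q, hq, hqx⟩
      refine ⟨q.2 - b, hq, Subtype.ext ?_⟩
      have h1 := x.2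
      rw [← hqx, ← hab, hs] at h1
      change h (a, b + (q.2 - b)) = x.1
      rw [← hqx]
      congr 1
      exact Prod.ext h1 (by simp)
  have key := line_lemma (leafG S hp) c cc ci co ?_ (fun x => U p x.1) ?_ ?_ ?_ ?_
  · rwa [c0] at key
  · rw [c0]; exact Subtype.ext hp
  · exact S.cU.comp (continuous_const.prodMk continuous_subtype_val)
  · intro x hx
    rw [c0] at hx ⊢
    have hne : p ≠ x.1 := fun h' => hx (Subtype.ext h'.symm)
    have h1 : U p x.1 ≠ 0 := fun h' => hne ((S.zero _ _).1 h')
    have h2 := S.tri p x.1 p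
    rw [(S.zero p p).2 rfl, S.sym x.1 p] at h2
    simp only [(S.zero p p).2 rfl]
    exact lt_of_le_of_ne (by linarith) h1.symm
  · intro x hx
    rw [c0] at hx
    have hne : p ≠ x.1 := fun h' => hx (Subtype.ext h'.symm)
    have h1 := S.conv _ _ hne
    have h2 := x.2 1
    have h3 := x.2 0
    have e2 : ((f ^ ((1:ℤ) + 1) : Equiv.Perm (ℝ × ℝ))) x.1 = f (f x.1) := by
      rw [zpow_succ_apply]; simp
    have e3 : ((f ^ ((1:ℤ) + 1) : Equiv.Perm (ℝ × ℝ))) p = f (f p) := by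
      rw [zpow_succ_apply]; simp
    rw [e2, e3] at h2
    simp only [zpow_one, hp] at h2
    simp only [Wd, hp] at h1
    change U p (f x.1) < U p x.1
    linarith
  · intro x
    rw [c0]; exact leafG_tendsto S hp x

theorem leaf_lin {X : Type*} [TopologicalSpace X] (G : X ≃ₜ X) (p : X) (H : X ≃ₜ ℝ) (hH : H p = 0)
    (hG : G p = p) (hx : ∀ x, Tendsto (fun n => G^[n] x) atTop (𝓝 p)) (x₁ : X) (h1 : 0 < H x₁)
    (h2 : 0 < H (G x₁)) : ∃ H' : X ≃ₜ ℝ, ∀ x, H' (G x) = H' x / 2 := by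
  set β : ℝ ≃ₜ ℝ := H.symm.trans (G.trans H) with hβ
  have βH : ∀ x, β (H x) = H (G x) := fun x => by simp [hβ]
  have β0 : β 0 = 0 := by rw [← hH, βH, hG]
  have βm : StrictMono β := by
    rcases β.continuous.strictMono_of_inj β.injective with h | h
    · exact h
    · have := h h1
      rw [β0, βH] at this
      linarith
  have βn : ∀ (n : ℕ) x, β^[n] (H x) = H (G^[n] x) := by
    intro n x
    induction n with
    | zero => rfl
    | succ n ih => rw [Function.iterate_succ_apply', ih, βH, Function.iterate_succ_apply']
  have βt : ∀ t, Tendsto (fun n => β^[n] t) atTop (𝓝 0) := by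
    intro t
    obtain ⟨x, rfl⟩ := H.surjective t
    simp only [βn]
    rw [← hH]
    exact (H.continuous.tendsto p).comp (hx x)
  obtain ⟨K, hK⟩ := lin_conj (βm.orderIsoOfSurjective β β.surjective) β0 (by
    intro t ht
    change β t < t
    by_contra hc
    push Not at hc
    have : ∀ n, t ≤ β^[n] t := by
      intro n
      induction n with
      | zero => exact le_rfl
      | succ n ih =>
        rw [Function.iterate_succ_apply']
        exact hc.trans (βm.monotone ih)
    have := ge_of_tendsto' (βt t) this
    linarith) (by
    intro t ht
    change t < β t
    by_contra hc
    push Not at hc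
    have : ∀ n, β^[n] t ≤ t := by
      intro n
      induction n with
      | zero => exact le_rfl
      | succ n ih =>
        rw [Function.iterate_succ_apply']
        exact (βm.monotone ih).trans hc
    have := le_of_tendsto' (βt t) this
    linarith)
  refine ⟨H.trans K, fun x => ?_⟩
  have := hK (H x)
  change K (β (H x)) = _ at this
  rw [βH] at this
  exact this

theorem pos_on_comp {A : Set (ℝ × ℝ)} {a : ℝ × ℝ → ℝ} (ha : Continuous a) (h0 : ∀ x ∈ A, a x ≠ 0)
    {q r : ℝ × ℝ} (hq : q ∈ A) (hq1 : 0 < a q) (hr : r ∈ connectedComponentIn A q) : 0 < a r := by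
  by_contra hc
  push Not at hc
  have hpre := (isPreconnected_connectedComponentIn (x := q) (F := A)).image a ha.continuousOn
  obtain ⟨x, hx, hx0⟩ := hpre.ordConnected.out (mem_image_of_mem a hr)
    (mem_image_of_mem a (mem_connectedComponentIn hq)) ⟨hc, hq1.le⟩
  exact h0 x (connectedComponentIn_subset _ _ hx) hx0

end Helpers

/-- under condition HP (with the both-signs condition, no
singularities and invariant quadrants), `f` is topologically conjugate to a
linear hyperbolic automorphism `L_λ(x,y) = (λ·x, λ⁻¹·y)`. -/
theorem conjugate_to_linear_hyperbolic
    (f : Equiv.Perm (ℝ × ℝ)) (hf : Continuous f) (hf' : Continuous f.symm)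
    (p : ℝ × ℝ) (hfix : f p = p)
    (U : ℝ × ℝ → ℝ × ℝ → ℝ) (hU : IsLyapunovMetric f U)
    (hBS : BothSigns f U) (hHP : CondHP f U)
    (hNS : NoSingularities f U) (hQI : QuadrantsInvariant f U p) :
    ∃ l : ℝ, 1 < l ∧ ∃ h : ℝ × ℝ ≃ₜ ℝ × ℝ,
      ∀ z : ℝ × ℝ, h (f z) = (l * (h z).1, l⁻¹ * (h z).2) := by
  have S : Sys f U := Sys.mk' f hf hf' U hU hHP hNS
  obtain ⟨br, brc, hbr⟩ := S.ps.bracket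
  have hfix' : f⁻¹ p = p := by rw [Equiv.Perm.inv_eq_iff_eq, hfix]
  have uq : ∀ x y z, Rs f U x y → Rs f⁻¹ U x z → br (y, z) = x := fun x y z h1 h2 =>
    S.ps.uniq (hbr (y, z)).1 (hbr (y, z)).2 h1 h2
  have brf : ∀ y z, br (f y, f z) = f (br (y, z)) := by
    intro y z
    refine uq _ _ _ (hbr (y, z)).1.map ?_
    have := (hbr (y, z)).2.map_inv
    simpa using this
  let Ψ : ℝ × ℝ ≃ₜ {x // Rs f⁻¹ U p x} × {x // Rs f U p x} :=
    { toFun := fun q => (⟨br (q, p), S.inv.symm (hbr (q, p)).2⟩, ⟨br (p, q), S.symm (hbr (p, q)).1⟩)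
      invFun := fun w => br (w.1.1, w.2.1)
      left_inv := fun q => uq _ _ _ (S.symm (hbr (q, p)).1) (S.inv.symm (hbr (p, q)).2)
      right_inv := fun w => by
        refine Prod.ext (Subtype.ext ?_) (Subtype.ext ?_)
        · exact uq _ _ _ (S.symm (hbr (w.1.1, w.2.1)).1) (S.inv.symm w.1.2)
        · exact uq _ _ _ (S.symm w.2.2) (S.inv.symm (hbr (w.1.1, w.2.1)).2)
      continuous_toFun := by
        refine Continuous.prodMk (Continuous.subtype_mk ?_ _) (Continuous.subtype_mk ?_ _)
        · exact brc.comp (Continuous.prodMk continuous_id continuous_const)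
        · exact brc.comp (Continuous.prodMk continuous_const continuous_id)
      continuous_invFun := brc.comp (Continuous.prodMk
        (continuous_subtype_val.comp continuous_fst) (continuous_subtype_val.comp continuous_snd)) }
  let Gs := leafG S hfix
  let Gu := leafG S.inv hfix'
  have Ψ1 : ∀ q, Gu (Ψ (f q)).1 = (Ψ q).1 := by
    intro q
    refine Subtype.ext ?_
    change f⁻¹ (br (f q, p)) = br (q, p)
    rw [Equiv.Perm.inv_eq_iff_eq, ← brf, hfix]
  have Ψ2 : ∀ q, (Ψ (f q)).2 = Gs (Ψ q).2 := by
    intro q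
    refine Subtype.ext ?_
    change br (p, f q) = f (br (p, q))
    rw [← brf, hfix]
  obtain ⟨Hs, Hs0⟩ := leaf_line S hfix
  obtain ⟨Hu, Hu0⟩ := leaf_line S.inv hfix'
  set ps : {x // Rs f U p x} := ⟨p, S.refl p⟩ with hps
  set pu : {x // Rs f⁻¹ U p x} := ⟨p, S.inv.refl p⟩ with hpu
  have hWs : ∀ x, (Ψ x).1 = pu → x ∈ Ws f U p := by
    intro x hx
    have h1 : br (x, p) = p := Subtype.ext_iff.1 hx
    have h2 := (hbr (x, p)).1
    rw [h1, S.bdd_iff] at h2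
    obtain ⟨K, hK⟩ := h2
    exact ⟨max K 1, lt_max_of_lt_right one_pos, fun n hn => (hK n hn).trans (le_max_left _ _)⟩
  have hWu : ∀ x, (Ψ x).2 = ps → x ∈ Wu f U p := by
    intro x hx
    have h1 : br (p, x) = p := Subtype.ext_iff.1 hx
    have h2 := (hbr (p, x)).2
    rw [h1, S.inv.bdd_iff] at h2
    obtain ⟨K, hK⟩ := h2
    refine ⟨max K 1, lt_max_of_lt_right one_pos, fun n hn => ?_⟩
    have := hK (-n) (by omega)
    rw [inv_zpow_apply, inv_zpow_apply, neg_neg] at this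
    exact this.trans (le_max_left _ _)
  have hWs' : ∀ x, x ∈ Ws f U p → (Ψ x).1 = pu := by
    rintro x ⟨K, -, hK⟩
    have h1 : Rs f U p x := (S.bdd_iff _ _).2 ⟨K, hK⟩
    exact Subtype.ext (uq _ _ _ h1 (S.inv.refl p))
  have hWu' : ∀ x, x ∈ Wu f U p → (Ψ x).2 = ps := by
    rintro x ⟨K, -, hK⟩
    have h1 : Rs f⁻¹ U p x := (S.inv.bdd_iff _ _).2 ⟨K, fun n hn => by
      rw [inv_zpow_apply, inv_zpow_apply]; exact hK (-n) (by omega)⟩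
    exact Subtype.ext (uq _ _ _ (S.refl p) h1)
  set A : Set (ℝ × ℝ) := (Ws f U p ∪ Wu f U p)ᶜ with hA
  have au : ∀ x ∈ A, Hu (Ψ x).1 ≠ 0 := fun x hx h =>
    hx (Or.inl (hWs x (Hu.injective (h.trans Hu0.symm))))
  have as : ∀ x ∈ A, Hs (Ψ x).2 ≠ 0 := fun x hx h =>
    hx (Or.inr (hWu x (Hs.injective (h.trans Hs0.symm))))
  set q : ℝ × ℝ := Ψ.symm (Hu.symm 1, Hs.symm 1) with hq
  have q1 : Hu (Ψ q).1 = 1 := by rw [hq, Ψ.apply_symm_apply]; simp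
  have q2 : Hs (Ψ q).2 = 1 := by rw [hq, Ψ.apply_symm_apply]; simp
  have hqn : q ∉ Ws f U p ∪ Wu f U p := by
    rintro (h | h)
    · rw [hWs' q h, Hu0] at q1; exact zero_ne_one q1
    · rw [hWu' q h, Hs0] at q2; exact zero_ne_one q2
  have hqA : q ∈ A := hqn
  have hfq : f q ∈ connectedComponentIn A q := by
    rw [← hQI q hqn]
    exact Set.mem_image_of_mem f (mem_connectedComponentIn hqA)
  have cu : Continuous (fun x => Hu (Ψ x).1) :=
    Hu.continuous.comp (continuous_fst.comp Ψ.continuous)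
  have cs : Continuous (fun x => Hs (Ψ x).2) :=
    Hs.continuous.comp (continuous_snd.comp Ψ.continuous)
  have pu1 : 0 < Hu (Ψ (f q)).1 := pos_on_comp cu au hqA (by rw [q1]; exact one_pos) hfq
  have ps1 : 0 < Hs (Ψ (f q)).2 := pos_on_comp cs as hqA (by rw [q2]; exact one_pos) hfq
  obtain ⟨Ku, hKu⟩ := leaf_lin Gu pu Hu Hu0 (Subtype.ext hfix') (leafG_tendsto S.inv hfix')
    (Ψ (f q)).1 pu1 (by rw [Ψ1, q1]; exact one_pos)
  obtain ⟨Ks, hKs⟩ := leaf_lin Gs ps Hs Hs0 (Subtype.ext hfix) (leafG_tendsto S hfix)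
    (Ψ q).2 (by rw [q2]; exact one_pos) (by rw [← Ψ2]; exact ps1)
  refine ⟨2, one_lt_two, Ψ.trans (Ku.prodCongr Ks), fun z => ?_⟩
  have e1 := hKu (Ψ (f z)).1
  rw [Ψ1] at e1
  have e2 := hKs (Ψ z).2
  rw [← Ψ2] at e2
  change (Ku (Ψ (f z)).1, Ks (Ψ (f z)).2) = (2 * Ku (Ψ z).1, 2⁻¹ * Ks (Ψ z).2)
  refine Prod.ext ?_ ?_
  · change Ku (Ψ (f z)).1 = 2 * Ku (Ψ z).1
    rw [e1]; ring
  · change Ks (Ψ (f z)).2 = 2⁻¹ * Ks (Ψ z).2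
    rw [e2]; ring
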